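/- arXiv:2408.17176 — 3 statements merged into one kernel-verified Lean document; each statement's English description precedes it below -/
import Mathlib

section
/- Let k, r ∈ ℕ with k ≥ 3, let δ₀ = (2r)^(−2^(k+1)) and α = 2^5·r·k·(2r)^(2^(k+1)). There exists n₀ = n₀(r,k) such that for every n ≥ n₀, every r-edge-coloured K_n^(k) (call it H) and all disjoint subsets X, Z of V(H) with |X| ≥ α·|Z|, there exists a set 𝒞 of vertex-disjoint monochromatic tight cycles covering Z such that |𝒞| ≤ 2^18·r·δ₀^(−5) and the cycles of 𝒞 use exactly (k−1)·|Z| vertices of X. -/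
/-- A vertex set `C` forms a monochromatic tight cycle in the `χ`-edge-coloured complete
`k`-graph on `Fin n`: either `C` is degenerate (at most `k` vertices), or the vertices of `C`
can be cyclically ordered so that every `k` consecutive vertices form an edge, all of these
edges having the same colour. -/
def MonoTightCycle {n : ℕ} {α : Type*} (k : ℕ) (χ : Finset (Fin n) → α)
    (C : Finset (Fin n)) : Prop :=
  C.card ≤ k ∨
  ∃ (g : ℕ → Fin n) (c : α),
    (∀ i, g (i + C.card) = g i) ∧
    Set.InjOn g (Set.Iio C.card) ∧
    (Finset.range C.card).image g = C ∧
    ∀ i, χ ((Finset.range k).image (fun j => g (i + j))) = c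
theorem exists_large_inter {ι τ : Type*} [DecidableEq τ] [Fintype τ]
    (I : Finset ι) (S : ι → Finset τ) (γ : ℝ)
    (hτ : 0 < Fintype.card τ)
    (hS : ∀ i ∈ I, γ * Fintype.card τ ≤ (S i).card) (hI : 2 < γ * I.card) :
    ∃ i ∈ I, ∃ j ∈ I, i ≠ j ∧ γ ^ 2 / 2 * Fintype.card τ ≤ ((S i ∩ S j).card : ℝ) := by
  classical
  by_contra! hcon
  set N : ℝ := (Fintype.card τ : ℝ) with hN
  have hNpos : 0 < N := by rw [hN]; exact_mod_cast hτ
  set D : ℝ := ∑ i ∈ I, ((S i).card : ℝ) with hD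
  let d : τ → ℝ := fun x => ∑ i ∈ I, if x ∈ S i then (1 : ℝ) else 0
  have hdD : ∑ x, d x = D := by
    simp only [d]
    rw [Finset.sum_comm]
    simp [hD]
  have hd2 : ∑ x, d x ^ 2 = ∑ i ∈ I, ∑ j ∈ I, ((S i ∩ S j).card : ℝ) := by
    have h1 : ∀ x, d x ^ 2 = ∑ i ∈ I, ∑ j ∈ I, if x ∈ S i ∩ S j then (1 : ℝ) else 0 := by
      intro x
      rw [sq, Finset.sum_mul_sum]
      refine Finset.sum_congr rfl fun i _ => Finset.sum_congr rfl fun j _ => ?_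
      by_cases h : x ∈ S i <;> by_cases h' : x ∈ S j <;> simp [h, h']
    simp_rw [h1]
    rw [Finset.sum_comm]
    refine Finset.sum_congr rfl fun i _ => ?_
    rw [Finset.sum_comm]
    refine Finset.sum_congr rfl fun j _ => ?_
    rw [Finset.sum_ite_mem, Finset.univ_inter]
    simp
  have hCS : D ^ 2 ≤ N * ∑ x, d x ^ 2 := by
    rw [← hdD]
    have := sq_sum_le_card_mul_sum_sq (s := (Finset.univ : Finset τ)) (f := d)
    simpa [hN] using this
  have hup : ∑ i ∈ I, ∑ j ∈ I, ((S i ∩ S j).card : ℝ) ≤ D + I.card * (I.card * (γ ^ 2 / 2 * N)) := by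
    have : ∀ i ∈ I, ∑ j ∈ I, ((S i ∩ S j).card : ℝ) ≤ (S i).card + I.card * (γ ^ 2 / 2 * N) := by
      intro i hi
      have : ∀ j ∈ I, ((S i ∩ S j).card : ℝ) ≤
          (if i = j then ((S i).card : ℝ) else 0) + γ ^ 2 / 2 * N := by
        intro j hj
        by_cases h : i = j
        · subst h
          simp only [Finset.inter_self, if_true]
          have : 0 ≤ γ ^ 2 / 2 * N := by positivity
          linarith
        · simpa [h] using (hcon i hi j hj h).le
      refine (Finset.sum_le_sum this).trans ?_
      rw [Finset.sum_add_distrib]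
      simp [hi]
    refine (Finset.sum_le_sum this).trans ?_
    rw [Finset.sum_add_distrib]
    simp [hD]
  have hDlow : γ * I.card * N ≤ D := by
    have := Finset.sum_le_sum hS
    rw [Finset.sum_const, nsmul_eq_mul] at this
    linarith
  rw [hd2] at hCS
  have h3 : D ^ 2 ≤ N * (D + I.card * (I.card * (γ ^ 2 / 2 * N))) :=
    hCS.trans (mul_le_mul_of_nonneg_left hup hNpos.le)
  set y : ℝ := γ * I.card * N with hy
  have hy2 : 2 * N < y := by rw [hy]; exact mul_lt_mul_of_pos_right hI hNpos
  have h4 : D ^ 2 - N * D ≤ y ^ 2 / 2 := by rw [hy]; nlinarith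
  nlinarith [mul_nonneg (sub_nonneg.2 hDlow) (by linarith : (0:ℝ) ≤ D + y - N)]

theorem exists_matching {V : Type*} [DecidableEq V] (R : V → V → Prop) (M : ℕ) (W : Finset V)
    (hW : ∀ I ⊆ W, M ≤ I.card → ∃ x ∈ I, ∃ y ∈ I, x ≠ y ∧ R x y) :
    ∃ (A : Finset V) (φ : V → V), A ⊆ W ∧
      (∀ a ∈ A, φ a ∈ W ∧ φ a ∉ A ∧ φ (φ a) = a ∧ R a (φ a)) ∧
      (W \ (A ∪ A.image φ)).card ≤ M := by
  induction W using Finset.strongInduction with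
  | H W ih =>
  by_cases hM : M ≤ W.card
  · obtain ⟨x, hx, y, hy, hxy, hR⟩ := hW W subset_rfl hM
    have hss : W \ {x, y} ⊂ W :=
      Finset.sdiff_ssubset (by simp [Finset.insert_subset_iff, hx, hy]) (by simp)
    obtain ⟨A, φ, hAW, hφ, hcard⟩ := ih _ hss fun I hI => hW I (hI.trans Finset.sdiff_subset)
    have hA : ∀ a ∈ A, a ∈ W ∧ a ≠ x ∧ a ≠ y := fun a ha => by simpa using hAW ha
    have hB : ∀ a ∈ A, φ a ∈ W ∧ φ a ≠ x ∧ φ a ≠ y := fun a ha => by simpa using (hφ a ha).1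
    let ψ : V → V := fun z => if z = x then y else if z = y then x else φ z
    have hψx : ψ x = y := by simp [ψ]
    have hψy : ψ y = x := by simp [ψ, hxy.symm]
    have hψ : ∀ z, z ≠ x → z ≠ y → ψ z = φ z := fun z h1 h2 => by simp [ψ, h1, h2]
    have hψA : ∀ a ∈ A, ψ a = φ a := fun a ha => hψ a (hA a ha).2.1 (hA a ha).2.2
    refine ⟨insert x A, ψ, ?_, ?_, ?_⟩
    · exact Finset.insert_subset hx (hAW.trans Finset.sdiff_subset)
    · intro a ha
      rcases Finset.mem_insert.1 ha with rfl | ha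
      · rw [hψx, hψy]
        refine ⟨hy, ?_, rfl, hR⟩
        rw [Finset.mem_insert]
        rintro (h | h)
        · exact hxy h.symm
        · exact (hA _ h).2.2 rfl
      · rw [hψA a ha, hψ (φ a) (hB a ha).2.1 (hB a ha).2.2]
        refine ⟨(hB a ha).1, ?_, (hφ a ha).2.2⟩
        rw [Finset.mem_insert]
        rintro (h | h)
        · exact (hB a ha).2.1 h
        · exact (hφ a ha).2.1 h
    · refine le_trans (Finset.card_le_card ?_) hcard
      intro z
      simp only [Finset.mem_sdiff, Finset.mem_union, Finset.mem_insert, Finset.mem_image,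
        Finset.mem_singleton]
      rintro ⟨hz, hn⟩
      push Not at hn
      obtain ⟨⟨hzx, hzA⟩, hzi⟩ := hn
      have hzy : z ≠ y := fun h => hzi x (Or.inl rfl) (hψx.trans h.symm)
      refine ⟨⟨hz, by tauto⟩, ?_⟩
      rintro (h | ⟨a, ha, h⟩)
      · exact hzA h
      · exact hzi a (Or.inr ha) ((hψA a ha).trans h)
  · exact ⟨∅, id, by simp, by simp, by simpa using (not_le.1 hM).le⟩

/-- `IsCyclicOrder A g`: `g` lists the elements of `A` periodically, each once per period. -/
def IsCyclicOrder {V : Type*} [DecidableEq V] (A : Finset V) (g : ℕ → V) : Prop :=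
  (∀ i, g (i + A.card) = g i) ∧ Set.InjOn g (Set.Iio A.card) ∧ (Finset.range A.card).image g = A

theorem IsCyclicOrder.mem {V : Type*} [DecidableEq V] {A : Finset V} {g : ℕ → V}
    (h : IsCyclicOrder A g) (hA : A.Nonempty) (i : ℕ) : g i ∈ A := by
  induction i using Nat.strong_induction_on with
  | _ i ih =>
    by_cases hi : i < A.card
    · have := Finset.mem_image_of_mem g (Finset.mem_range.2 hi)
      rwa [h.2.2] at this
    · have hpos := hA.card_pos
      have h2 := ih (i - A.card) (by omega)
      rwa [← h.1, Nat.sub_add_cancel (by omega)] at h2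

theorem exists_longest_path {V : Type*} (R : V → V → Prop) (W : Finset V)
    (hW : W.Nonempty) :
    ∃ (n : ℕ) (e : ℕ → V), 0 < n ∧ (∀ i < n, e i ∈ W) ∧ Set.InjOn e (Set.Iio n) ∧
      (∀ i, i + 1 < n → R (e i) (e (i + 1))) ∧
      ∀ u ∈ W, R u (e 0) → ∃ i < n, e i = u := by
  classical
  let P : ℕ → Prop := fun n => ∃ e : ℕ → V, (∀ i < n, e i ∈ W) ∧ Set.InjOn e (Set.Iio n) ∧
      (∀ i, i + 1 < n → R (e i) (e (i + 1)))
  have hbound : ∀ n, P n → n ≤ W.card := by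
    rintro n ⟨e, he, hinj, -⟩
    have := Finset.card_le_card_of_injOn (s := Finset.range n) (t := W) e
      (fun i hi => he i (by simpa using hi)) (by simpa using hinj)
    simpa using this
  obtain ⟨w, hw⟩ := hW
  have h1 : P 1 := ⟨fun _ => w, fun _ _ => hw, by
    intro i hi j hj _
    simp at hi hj
    omega, fun i hi => by omega⟩
  set n := Nat.findGreatest P W.card with hn
  have hPn : P n := Nat.findGreatest_spec (hbound 1 h1) h1
  have hn1 : 1 ≤ n := Nat.le_findGreatest (hbound 1 h1) h1
  obtain ⟨e, he, hinj, hch⟩ := hPn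
  refine ⟨n, e, hn1, he, hinj, hch, ?_⟩
  intro u hu hR
  by_contra! hcon
  have : P (n + 1) := by
    refine ⟨fun i => Nat.casesOn i u e, ?_, ?_, ?_⟩
    · rintro (_ | i) hi
      · exact hu
      · exact he i (by omega)
    · rintro (_ | i) hi (_ | j) hj h
      · rfl
      · exact absurd h.symm (hcon j (by simpa using hj))
      · exact absurd h (hcon i (by simpa using hi))
      · congr 1
        exact hinj (by simpa using hi) (by simpa using hj) h
    · rintro (_ | i) hi
      · exact hR
      · exact hch i (by omega)
  have := Nat.le_findGreatest (hbound _ this) this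
  omega

/-- A reflexive symmetric relation whose independent sets have at most `a` elements can be
covered by at most `a` disjoint cycles. -/
theorem exists_cycle_cover {V : Type*} [DecidableEq V] (R : V → V → Prop)
    (hsymm : ∀ x y, R x y → R y x) (a : ℕ) (W : Finset V) (hrefl : ∀ x ∈ W, R x x)
    (hW : ∀ I ⊆ W, a < I.card → ∃ x ∈ I, ∃ y ∈ I, x ≠ y ∧ R x y) :
    ∃ (𝒬 : Finset (Finset V)) (prev : V → V), 𝒬.card ≤ a ∧
      (𝒬 : Set (Finset V)).PairwiseDisjoint id ∧ 𝒬.biUnion id = W ∧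
      (∀ p ∈ W, prev p ∈ W ∧ R p (prev p)) ∧
      ∀ A ∈ 𝒬, A.Nonempty ∧ ∃ g, IsCyclicOrder A g ∧ ∀ i, prev (g (i + 1)) = g i := by
  induction a generalizing W with
  | zero =>
    have : W = ∅ := by
      by_contra h
      obtain ⟨x, hx⟩ := Finset.nonempty_iff_ne_empty.2 h
      obtain ⟨y, hy, z, hz, hne, -⟩ := hW {x} (by simpa using hx) (by simp)
      simp at hy hz
      exact hne (hy.trans hz.symm)
    subst this
    exact ⟨∅, id, by simp, by simp, by simp, by simp, by simp⟩
  | succ a ih =>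
    rcases W.eq_empty_or_nonempty with rfl | hne
    · exact ⟨∅, id, by simp, by simp, by simp, by simp, by simp⟩
    obtain ⟨n, e, hn, heW, hinj, hch, hmax⟩ := exists_longest_path R W hne
    classical
    set v := e 0 with hv
    have hvW : v ∈ W := heW 0 hn
    let i₀ := Nat.findGreatest (fun i => i < n ∧ R v (e i)) n
    have hi₀ : i₀ < n ∧ R v (e i₀) :=
      Nat.findGreatest_spec (P := fun i => i < n ∧ R v (e i)) (Nat.zero_le n) ⟨hn, hrefl v hvW⟩
    have hi₀max : ∀ i < n, R v (e i) → i ≤ i₀ := fun i hi hR =>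
      Nat.le_findGreatest (P := fun i => i < n ∧ R v (e i)) hi.le ⟨hi, hR⟩
    obtain ⟨q, hq⟩ : ∃ q, q = i₀ + 1 := ⟨_, rfl⟩
    have hqpos : 0 < q := by omega
    have hqn : q ≤ n := by omega
    have hinjq : Set.InjOn e (Set.Iio q) := hinj.mono (Set.Iio_subset_Iio hqn)
    let A : Finset V := (Finset.range q).image e
    have hAcard : A.card = q := by
      rw [Finset.card_image_of_injOn (by simpa using hinjq), Finset.card_range]
    let g : ℕ → V := fun i => e (i % q)
    have hgA : ∀ i, g i ∈ A := fun i =>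
      Finset.mem_image_of_mem _ (Finset.mem_range.2 (Nat.mod_lt _ hqpos))
    have hg : IsCyclicOrder A g := by
      refine ⟨fun i => by simp [g, hAcard], ?_, ?_⟩
      · rw [hAcard]
        intro i hi j hj h
        simp only [g, Nat.mod_eq_of_lt hi, Nat.mod_eq_of_lt hj] at h
        exact hinjq hi hj h
      · rw [hAcard]
        refine Finset.image_congr ?_
        intro i hi
        have hi' : i < q := by simpa using hi
        simp only [g, Nat.mod_eq_of_lt hi']
    have hgR : ∀ i, R (g i) (g (i + 1)) := by
      intro i
      have hlt := Nat.mod_lt i hqpos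
      have hadd : (i + 1) % q = (i % q + 1) % q := by simp
      simp only [g, hadd]
      by_cases h : i % q + 1 = q
      · rw [h, Nat.mod_self]
        have : i % q = i₀ := by omega
        rw [this]
        exact hsymm _ _ hi₀.2
      · rw [Nat.mod_eq_of_lt (by omega : i % q + 1 < q)]
        exact hch _ (by omega)
    have hAW : A ⊆ W := by
      intro x hx
      obtain ⟨i, hi, rfl⟩ := Finset.mem_image.1 hx
      exact heW i (lt_of_lt_of_le (Finset.mem_range.1 hi) hqn)
    have hvA : v ∈ A := Finset.mem_image.2 ⟨0, by simpa using hqpos, rfl⟩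
    have hvR : ∀ u ∈ W \ A, ¬ R v u := by
      intro u hu hR
      obtain ⟨huW, huA⟩ := Finset.mem_sdiff.1 hu
      obtain ⟨i, hi, rfl⟩ := hmax u huW (hsymm _ _ hR)
      exact huA (Finset.mem_image.2 ⟨i, by simpa [hq] using Nat.lt_succ_of_le (hi₀max i hi hR), rfl⟩)
    obtain ⟨𝒬, prev, hcard, hdisj, hun, hprev, hcyc⟩ := ih (W \ A)
      (fun x hx => hrefl x (Finset.sdiff_subset hx)) (by
        intro I hI hIc
        have hvI : v ∉ I := fun h => (Finset.mem_sdiff.1 (hI h)).2 hvA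
        obtain ⟨x, hx, y, hy, hxy, hR⟩ := hW (insert v I)
          (Finset.insert_subset hvW (hI.trans Finset.sdiff_subset))
          (by rw [Finset.card_insert_of_notMem hvI]; omega)
        rcases Finset.mem_insert.1 hx with rfl | hx
        · rcases Finset.mem_insert.1 hy with rfl | hy
          · exact absurd rfl hxy
          · exact absurd hR (hvR y (hI hy))
        · rcases Finset.mem_insert.1 hy with rfl | hy
          · exact absurd (hsymm _ _ hR) (hvR x (hI hx))
          · exact ⟨x, hx, y, hy, hxy, hR⟩)
    have hsub : ∀ B ∈ 𝒬, B ⊆ W \ A := fun B hB => by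
      rw [← hun]; exact Finset.subset_biUnion_of_mem id hB
    let prevA : V → V := fun p => g (Function.invFunOn e (Set.Iio q) p + (q - 1))
    have hprevA : ∀ i, prevA (g (i + 1)) = g i := by
      intro i
      have h1 : Function.invFunOn e (Set.Iio q) (e ((i + 1) % q)) = (i + 1) % q :=
        hinjq.leftInvOn_invFunOn (Nat.mod_lt _ hqpos)
      simp only [prevA, g]
      rw [h1, Nat.mod_add_mod, show i + 1 + (q - 1) = i + q by omega, Nat.add_mod_right]
    refine ⟨insert A 𝒬, fun p => if p ∈ A then prevA p else prev p, ?_, ?_, ?_, ?_, ?_⟩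
    · exact (Finset.card_insert_le _ _).trans (by omega)
    · rw [Finset.coe_insert]
      refine hdisj.insert fun B hB _ => ?_
      exact Finset.disjoint_left.2 fun x hx hxB =>
        (Finset.mem_sdiff.1 (hsub B hB hxB)).2 hx
    · rw [Finset.biUnion_insert, hun]
      exact Finset.union_sdiff_of_subset hAW
    · intro p hp
      by_cases hpA : p ∈ A
      · simp only [hpA, if_true]
        obtain ⟨i, hi, rfl⟩ := Finset.mem_image.1 (hg.2.2.symm ▸ hpA)
        have : g i = g (i + (q - 1) + 1) := by
          rw [show i + (q - 1) + 1 = i + A.card by omega, hg.1]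
        rw [this, hprevA]
        exact ⟨hAW (hgA _), hsymm _ _ (hgR _)⟩
      · simp only [hpA, if_false]
        have := hprev p (Finset.mem_sdiff.2 ⟨hp, hpA⟩)
        exact ⟨Finset.sdiff_subset this.1, this.2⟩
    · intro B hB
      rcases Finset.mem_insert.1 hB with rfl | hB
      · exact ⟨⟨v, hvA⟩, g, hg, fun i => by simp only [hgA, if_true]; exact hprevA i⟩
      · obtain ⟨hBne, h, hh, hpr⟩ := hcyc B hB
        refine ⟨hBne, h, hh, fun i => ?_⟩
        have hmem : h (i + 1) ∈ B := hh.mem hBne _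
        have : h (i + 1) ∉ A := (Finset.mem_sdiff.1 (hsub B hB hmem)).2
        simp only [this, if_false, hpr]

/-- The pairs of `m`-tuples all of whose coordinatewise mixtures lie in `S`. -/
def boxPairs {m : ℕ} {α : Type*} [Fintype α] [DecidableEq α] (S : Finset (Fin m → α)) :
    Finset ((Fin m → α) × (Fin m → α)) :=
  Finset.univ.filter fun p => ∀ e : Fin m → Bool, (fun i => cond (e i) (p.1 i) (p.2 i)) ∈ S

theorem mem_boxPairs {m : ℕ} {α : Type*} [Fintype α] [DecidableEq α] {S : Finset (Fin m → α)}
    {f g : Fin m → α} :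
    (f, g) ∈ boxPairs S ↔ ∀ e : Fin m → Bool, (fun i => cond (e i) (f i) (g i)) ∈ S := by
  simp [boxPairs]

theorem boxPairs_symm {m : ℕ} {α : Type*} [Fintype α] [DecidableEq α] {S : Finset (Fin m → α)}
    {f g : Fin m → α} (h : (f, g) ∈ boxPairs S) : (g, f) ∈ boxPairs S := by
  rw [mem_boxPairs] at h ⊢
  intro e
  convert h (fun i => !e i) using 2 with i
  cases e i <;> rfl

theorem card_sq_le_sum_slices {m : ℕ} {α : Type*} [Fintype α] [DecidableEq α]
    (S : Finset (Fin (m + 1) → α)) :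
    (S.card : ℝ) ^ 2 ≤ (Fintype.card α : ℝ) ^ m * ∑ a : α × α, ((Finset.univ.filter
      fun f : Fin m → α => (Fin.cons a.1 f : Fin (m + 1) → α) ∈ S ∧
        (Fin.cons a.2 f : Fin (m + 1) → α) ∈ S).card : ℝ) := by
  let ind : α → (Fin m → α) → ℝ :=
    fun a f => if (Fin.cons a f : Fin (m + 1) → α) ∈ S then 1 else 0
  have h1 : (S.card : ℝ) = ∑ f : Fin m → α, ∑ a, ind a f := by
    rw [← Fintype.sum_prod_type']
    rw [← Equiv.sum_comp ((Equiv.prodComm (Fin m → α) α).trans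
      (Fin.consEquiv fun _ => α)).symm]
    have : ∀ x : Fin (m + 1) → α, ind (x 0) (fun i => x i.succ) = if x ∈ S then 1 else 0 := by
      intro x
      have : (Fin.cons (x 0) (fun i : Fin m => x i.succ) : Fin (m + 1) → α) = x :=
        Fin.cons_self_tail x
      simp only [ind, this]
    calc (S.card : ℝ) = ∑ x : Fin (m + 1) → α, if x ∈ S then (1 : ℝ) else 0 := by simp
      _ = _ := Finset.sum_congr rfl fun x _ => (this x).symm
  have h2 : ∑ a : α × α, ((Finset.univ.filter
      fun f : Fin m → α => (Fin.cons a.1 f : Fin (m + 1) → α) ∈ S ∧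
        (Fin.cons a.2 f : Fin (m + 1) → α) ∈ S).card : ℝ) = ∑ f : Fin m → α, (∑ a, ind a f) ^ 2 := by
    have h3 : ∀ f : Fin m → α, (∑ a, ind a f) ^ 2 = ∑ a : α × α,
        if (Fin.cons a.1 f : Fin (m + 1) → α) ∈ S ∧
        (Fin.cons a.2 f : Fin (m + 1) → α) ∈ S then (1 : ℝ) else 0 := by
      intro f
      rw [sq, Finset.sum_mul_sum, Fintype.sum_prod_type]
      refine Finset.sum_congr rfl fun a _ => Finset.sum_congr rfl fun b _ => ?_
      simp only [ind]
      by_cases h : (Fin.cons a f : Fin (m + 1) → α) ∈ S <;>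
        by_cases h' : (Fin.cons b f : Fin (m + 1) → α) ∈ S <;> simp [h, h']
    simp_rw [h3]
    rw [Finset.sum_comm]
    refine Finset.sum_congr rfl fun a _ => ?_
    simp
  rw [h1, h2]
  have := sq_sum_le_card_mul_sum_sq (s := (Finset.univ : Finset (Fin m → α)))
    (f := fun f => ∑ a, ind a f)
  simpa using this

theorem sum_card_boxPairs_slices_le {m : ℕ} {α : Type*} [Fintype α] [DecidableEq α]
    (S : Finset (Fin (m + 1) → α)) :
    ∑ a : α × α, (boxPairs (Finset.univ.filter
      fun f : Fin m → α => (Fin.cons a.1 f : Fin (m + 1) → α) ∈ S ∧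
        (Fin.cons a.2 f : Fin (m + 1) → α) ∈ S)).card ≤ (boxPairs S).card := by
  rw [← Finset.card_sigma]
  refine Finset.card_le_card_of_injOn
    (fun x => (Fin.cons x.1.1 x.2.1, Fin.cons x.1.2 x.2.2)) ?_ ?_
  · rintro ⟨⟨a, b⟩, f, g⟩ hx
    have hx' : (f, g) ∈ boxPairs _ := (Finset.mem_sigma.1 hx).2
    rw [mem_boxPairs] at hx'
    refine mem_boxPairs.2 fun e => ?_
    have h1 := (Finset.mem_filter.1 (hx' fun i => e i.succ)).2
    have h2 : (fun i => cond (e i) ((Fin.cons a f : Fin (m + 1) → α) i)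
        ((Fin.cons b g : Fin (m + 1) → α) i)) =
        (Fin.cons (cond (e 0) a b) (fun i => cond (e i.succ) (f i) (g i)) : Fin (m + 1) → α) := by
      funext i
      refine Fin.cases ?_ (fun i => ?_) i <;> simp
    simp only at h2 ⊢
    rw [h2]
    cases e 0
    · exact h1.2
    · exact h1.1
  · rintro ⟨⟨a, b⟩, f, g⟩ - ⟨⟨a', b'⟩, f', g'⟩ - h
    simp only [Prod.mk.injEq, Fin.cons_inj] at h
    obtain ⟨⟨rfl, rfl⟩, rfl, rfl⟩ := h
    rfl

/-- A set of `m`-tuples of density `d` contains at least a `d ^ 2 ^ m` proportion of the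
combinatorial boxes. -/
theorem card_boxPairs_ge {α : Type*} [Fintype α] [DecidableEq α] (hα : 0 < Fintype.card α)
    (m : ℕ) (S : Finset (Fin m → α)) :
    ((S.card : ℝ) / (Fintype.card α : ℝ) ^ m) ^ 2 ^ m * ((Fintype.card α : ℝ) ^ m) ^ 2 ≤
      (boxPairs S).card := by
  have hM : (0 : ℝ) < Fintype.card α := by exact_mod_cast hα
  induction m with
  | zero =>
    rcases S.eq_empty_or_nonempty with rfl | ⟨f, hf⟩
    · simp
    · have h1 : S.card ≤ 1 := by simpa using S.card_le_univ
      have h2 : 1 ≤ (boxPairs S).card := Finset.card_pos.2 ⟨(f, f), mem_boxPairs.2 fun e => by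
        convert hf⟩
      have : (S.card : ℝ) ≤ (boxPairs S).card := by exact_mod_cast h1.trans h2
      simpa using this
  | succ m ih =>
    set M : ℝ := (Fintype.card α : ℝ) with hMdef
    let slice : α × α → Finset (Fin m → α) := fun a => Finset.univ.filter
      fun f : Fin m → α => (Fin.cons a.1 f : Fin (m + 1) → α) ∈ S ∧
        (Fin.cons a.2 f : Fin (m + 1) → α) ∈ S
    let x : α × α → ℝ := fun a => ((slice a).card : ℝ) / M ^ m
    have hx : ∀ a, 0 ≤ x a := fun a => by positivity
    have hsum : ((S.card : ℝ) / M ^ (m + 1)) ^ 2 * M ^ 2 ≤ ∑ a, x a := by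
      have h := card_sq_le_sum_slices S
      have h' : ∑ a, x a = (∑ a, ((slice a).card : ℝ)) / M ^ m := by
        rw [Finset.sum_div]
      rw [h', le_div_iff₀ (by positivity)]
      calc ((S.card : ℝ) / M ^ (m + 1)) ^ 2 * M ^ 2 * M ^ m = (S.card : ℝ) ^ 2 / M ^ m := by
            field_simp
            ring
        _ ≤ _ := by
            rw [div_le_iff₀ (by positivity), mul_comm]
            exact h
    obtain ⟨t, ht⟩ : ∃ t, 2 ^ m = t + 1 := ⟨2 ^ m - 1, by have := Nat.one_le_two_pow (n := m); omega⟩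
    have hjensen := pow_sum_div_card_le_sum_pow (s := (Finset.univ : Finset (α × α))) (f := x)
      (fun a _ => hx a) t
    rw [← ht] at hjensen
    have hcard : ((Finset.univ : Finset (α × α)).card : ℝ) = M ^ 2 := by
      simp [hMdef, sq]
    rw [hcard] at hjensen
    have hbox : ∑ a, x a ^ 2 ^ m * (M ^ m) ^ 2 ≤ (boxPairs S).card := by
      refine (Finset.sum_le_sum fun a _ => ih (slice a)).trans ?_
      exact_mod_cast sum_card_boxPairs_slices_le S
    rw [← Finset.sum_mul] at hbox
    refine le_trans ?_ hbox
    set d : ℝ := (S.card : ℝ) / M ^ (m + 1) with hd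
    calc d ^ 2 ^ (m + 1) * (M ^ (m + 1)) ^ 2
        = ((d ^ 2 * M ^ 2) ^ 2 ^ m / (M ^ 2) ^ t) * (M ^ m) ^ 2 := by
          have : (d ^ 2 * M ^ 2) ^ 2 ^ m = d ^ 2 ^ (m + 1) * ((M ^ 2) ^ t * M ^ 2) := by
            rw [mul_pow, ← pow_mul, ← pow_succ' 2 m, ← pow_succ (M ^ 2) t, ← ht]
          rw [this]
          field_simp
          ring
      _ ≤ _ := by
          refine mul_le_mul_of_nonneg_right (le_trans ?_ hjensen) (by positivity)
          gcongr

theorem exists_avoiding {α : Type*} [Fintype α] [DecidableEq α] {m : ℕ}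
    (hα : 0 < Fintype.card α) (U : Finset α) (Q : Finset (Fin m → α))
    (hQ : (m * U.card : ℝ) / Fintype.card α * (Fintype.card α : ℝ) ^ m < Q.card) :
    ∃ f ∈ Q, ∀ i, f i ∉ U := by
  by_contra! hcon
  have hM : (0 : ℝ) < Fintype.card α := by exact_mod_cast hα
  set M : ℝ := (Fintype.card α : ℝ) with hMdef
  have h1 : Q ⊆ (Fintype.piFinset fun _ : Fin m => Uᶜ)ᶜ := by
    intro f hf
    obtain ⟨i, hi⟩ := hcon f hf
    simp only [Finset.mem_compl, Fintype.mem_piFinset, not_forall, not_not]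
    exact ⟨i, hi⟩
  have hUle : (U.card : ℝ) ≤ M := by rw [hMdef]; exact_mod_cast U.card_le_univ
  have h2 : (Q.card : ℝ) ≤ M ^ m - (M - U.card) ^ m := by
    have := Finset.card_le_card h1
    have h3 : ((Fintype.piFinset fun _ : Fin m => Uᶜ)ᶜ.card : ℝ) = M ^ m - (M - U.card) ^ m := by
      rw [Finset.card_compl, Nat.cast_sub (Finset.card_le_univ _)]
      simp [Finset.card_compl, Nat.cast_sub U.card_le_univ, hMdef]
    rw [← h3]
    exact_mod_cast this
  have h4 : (M - U.card) ^ m ≥ M ^ m * (1 - m * (U.card / M)) := by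
    have hb := one_add_mul_le_pow (a := -((U.card : ℝ) / M)) (by
      have : (U.card : ℝ) / M ≤ 1 := by rw [div_le_one hM]; exact hUle
      linarith) m
    calc M ^ m * (1 - m * (U.card / M)) ≤ M ^ m * (1 + -((U.card : ℝ) / M)) ^ m := by
          refine mul_le_mul_of_nonneg_left ?_ (by positivity)
          linarith
      _ = (M - U.card) ^ m := by
          rw [← mul_pow]; congr 1; field_simp; ring
  have h5 : (m * U.card : ℝ) / M * M ^ m = M ^ m * (m * (U.card / M)) := by ring
  rw [h5] at hQ
  linarith

/-- Greedy choice of pairwise disjoint tuples from large sets. -/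
theorem exists_disjoint_choice {ι α : Type*} [DecidableEq ι] [Fintype α] [DecidableEq α] {m : ℕ}
    (hα : 0 < Fintype.card α) (B : ℕ) (Q : ι → Finset (Fin m → α)) (U : Finset α) (J : Finset ι)
    (hQ : ∀ j ∈ J, (m * B : ℝ) / Fintype.card α * (Fintype.card α : ℝ) ^ m < (Q j).card)
    (hB : U.card + m * J.card ≤ B) :
    ∃ f : ι → Fin m → α, (∀ j ∈ J, f j ∈ Q j ∧ ∀ i, f j i ∉ U) ∧
      ∀ j ∈ J, ∀ j' ∈ J, j ≠ j' → ∀ i i', f j i ≠ f j' i' := by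
  induction J using Finset.induction_on with
  | empty =>
    obtain ⟨a⟩ := Fintype.card_pos_iff.1 hα
    exact ⟨fun _ _ => a, by simp, by simp⟩
  | insert j₀ J hj₀ ih =>
    rw [Finset.card_insert_of_notMem hj₀] at hB
    obtain ⟨f, hf, hdisj⟩ := ih (fun j hj => hQ j (Finset.mem_insert_of_mem hj))
      (by nlinarith)
    let U' := U ∪ J.biUnion fun j => Finset.univ.image (f j)
    have hU' : U'.card ≤ B := by
      refine (Finset.card_union_le _ _).trans ?_
      have : (J.biUnion fun j => Finset.univ.image (f j)).card ≤ J.card * m :=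
        Finset.card_biUnion_le_card_mul _ _ _ fun j _ => by
          simpa using Finset.card_image_le (s := Finset.univ) (f := f j)
      nlinarith
    obtain ⟨h, hhQ, hhU⟩ := exists_avoiding hα U' (Q j₀) (by
      refine lt_of_le_of_lt ?_ (hQ j₀ (Finset.mem_insert_self _ _))
      have : (U'.card : ℝ) ≤ B := by exact_mod_cast hU'
      gcongr)
    have hhU1 : ∀ i, h i ∉ U := fun i hi => hhU i (Finset.mem_union_left _ hi)
    have hhU2 : ∀ i, ∀ j ∈ J, ∀ i', f j i' ≠ h i := fun i j hj i' he =>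
      hhU i (Finset.mem_union_right _ (Finset.mem_biUnion.2
        ⟨j, hj, Finset.mem_image.2 ⟨i', Finset.mem_univ _, he⟩⟩))
    have hne : ∀ j ∈ J, j ≠ j₀ := fun j hj e => hj₀ (e ▸ hj)
    refine ⟨Function.update f j₀ h, ?_, ?_⟩
    · intro j hj
      rcases Finset.mem_insert.1 hj with rfl | hj
      · simpa using ⟨hhQ, hhU1⟩
      · simpa [hne j hj] using hf j hj
    · intro j hj j' hj' hjj i i'
      rcases Finset.mem_insert.1 hj with rfl | hjJ
      · rcases Finset.mem_insert.1 hj' with rfl | hjJ'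
        · exact absurd rfl hjj
        · simpa [hne j' hjJ'] using (hhU2 i j' hjJ' i').symm
      · rcases Finset.mem_insert.1 hj' with rfl | hjJ'
        · simpa [hne j hjJ] using hhU2 i' j hjJ i
        · simpa [hne j hjJ, hne j' hjJ'] using hdisj j hjJ j' hjJ' hjj i i'

theorem IsCyclicOrder.interleave {V : Type*} [DecidableEq V] {P : Finset V} {g : ℕ → V}
    (hg : IsCyclicOrder P g) (hP : P.Nonempty) {φ : V → V} (hφ : Set.InjOn φ P)
    (hdisj : ∀ a ∈ P, φ a ∉ P) :
    IsCyclicOrder (P ∪ P.image φ) fun j => if j % 2 = 0 then g (j / 2) else φ (g (j / 2)) := by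
  have hcard : (P ∪ P.image φ).card = 2 * P.card := by
    rw [Finset.card_union_of_disjoint, Finset.card_image_of_injOn hφ, two_mul]
    refine Finset.disjoint_left.2 fun x hx hx' => ?_
    obtain ⟨a, ha, rfl⟩ := Finset.mem_image.1 hx'
    exact hdisj a ha hx
  have hmem := hg.mem hP
  refine ⟨fun i => ?_, ?_, ?_⟩
  · beta_reduce
    rw [hcard, show (i + 2 * P.card) % 2 = i % 2 by omega,
      show (i + 2 * P.card) / 2 = i / 2 + P.card by omega, hg.1]
  · rw [hcard]
    intro i hi j hj h
    simp only [Set.mem_Iio] at hi hj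
    have hi2 : i / 2 ∈ Set.Iio P.card := by simp only [Set.mem_Iio]; omega
    have hj2 : j / 2 ∈ Set.Iio P.card := by simp only [Set.mem_Iio]; omega
    by_cases h1 : i % 2 = 0 <;> by_cases h2 : j % 2 = 0 <;> simp only [h1, h2, if_true, if_false] at h
    · have := hg.2.1 hi2 hj2 h
      omega
    · exact absurd (h ▸ hmem _) (hdisj _ (hmem (j / 2)))
    · exact absurd (h ▸ hmem _) (hdisj _ (hmem (i / 2)))
    · have := hg.2.1 hi2 hj2 (hφ (hmem _) (hmem _) h)
      omega
  · rw [hcard]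
    ext x
    simp only [Finset.mem_image, Finset.mem_range, Finset.mem_union]
    constructor
    · rintro ⟨j, -, rfl⟩
      by_cases h1 : j % 2 = 0
      · simp only [h1, if_true]
        exact Or.inl (hmem _)
      · simp only [h1, if_false]
        exact Or.inr ⟨_, hmem _, rfl⟩
    · have hex : ∀ a ∈ P, ∃ i < P.card, g i = a := fun a ha => by
        rw [← hg.2.2] at ha
        simpa using ha
      rintro (h | ⟨a, ha, rfl⟩)
      · obtain ⟨i, hi, rfl⟩ := hex x h
        exact ⟨2 * i, by omega, by simp⟩
      · obtain ⟨i, hi, rfl⟩ := hex a ha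
        refine ⟨2 * i + 1, by omega, ?_⟩
        rw [if_neg (by omega), show (2 * i + 1) / 2 = i by omega]

theorem exists_large_inter_of_colouring {ι τ : Type*} [DecidableEq τ] [Fintype τ] {r : ℕ}
    (hr : 0 < r) (col : ι → Fin r) (I : Finset ι) (S : ι → Finset τ) (γ : ℝ) (M : ℕ)
    (hτ : 0 < Fintype.card τ) (hS : ∀ i ∈ I, γ * Fintype.card τ ≤ (S i).card)
    (hM : 2 < γ * M) (hγ : 0 ≤ γ) (hI : r * M ≤ I.card) :
    ∃ i ∈ I, ∃ j ∈ I, i ≠ j ∧ col i = col j ∧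
      γ ^ 2 / 2 * Fintype.card τ ≤ ((S i ∩ S j).card : ℝ) := by
  obtain ⟨x, -, hx⟩ := Finset.exists_le_card_fiber_of_mul_le_card_of_maps_to
    (s := I) (t := Finset.univ) (f := col) (n := M) (fun _ _ => Finset.mem_univ _)
    ⟨⟨0, hr⟩, Finset.mem_univ _⟩ (by simpa using hI)
  obtain ⟨i, hi, j, hj, hij, h⟩ := exists_large_inter (I.filter fun i => col i = x) S γ hτ
    (fun i hi => hS i (Finset.mem_filter.1 hi).1) (by
      refine lt_of_lt_of_le hM ?_
      have : (M : ℝ) ≤ (I.filter fun i => col i = x).card := by exact_mod_cast hx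
      gcongr)
  rw [Finset.mem_filter] at hi hj
  exact ⟨i, hi.1, j, hj.1, hij, hi.2.trans hj.2.symm, h⟩

theorem card_dense_fibres_ge {τ : Type*} [DecidableEq τ] [Fintype τ] (hτ : 0 < Fintype.card τ)
    (G : Finset (τ × τ)) (γ : ℝ) (hγ : 0 ≤ γ)
    (hG : 2 * γ * (Fintype.card τ : ℝ) ^ 2 ≤ G.card) :
    γ * Fintype.card τ ≤ ((Finset.univ.filter fun f : τ => γ * Fintype.card τ ≤
      ((Finset.univ.filter fun f' : τ => (f, f') ∈ G).card : ℝ)).card : ℝ) := by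
  set N : ℝ := (Fintype.card τ : ℝ) with hN
  have hNpos : 0 < N := by rw [hN]; exact_mod_cast hτ
  let deg : τ → ℝ := fun f => ((Finset.univ.filter fun f' : τ => (f, f') ∈ G).card : ℝ)
  have hsum : (G.card : ℝ) = ∑ f, deg f := by
    have : G.card = ∑ f : τ, (Finset.univ.filter fun f' : τ => (f, f') ∈ G).card := by
      rw [← Finset.card_sigma]
      refine Finset.card_bij (fun p _ => ⟨p.1, p.2⟩) ?_ ?_ ?_
      · rintro ⟨a, b⟩ h
        simpa using h
      · rintro ⟨a, b⟩ - ⟨a', b'⟩ - h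
        simpa using h
      · rintro ⟨a, b⟩ h
        exact ⟨(a, b), by simpa using h, rfl⟩
    simp only [deg]
    exact_mod_cast this
  have hle : ∀ f, deg f ≤ (if γ * N ≤ deg f then N else 0) + γ * N := by
    intro f
    have h1 : deg f ≤ N := by
      simp only [deg, hN]
      exact_mod_cast Finset.card_le_univ _
    have h2 : 0 ≤ γ * N := by positivity
    split_ifs with h
    · linarith
    · linarith
  have h3 := Finset.sum_le_sum fun f (_ : f ∈ Finset.univ) => hle f
  rw [← hsum, Finset.sum_add_distrib, ← Finset.sum_filter, Finset.sum_const, Finset.sum_const,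
    nsmul_eq_mul, nsmul_eq_mul, Finset.card_univ, ← hN] at h3
  have h4 : N * (γ * N) ≤ N * ((Finset.univ.filter fun f : τ => γ * N ≤ deg f).card : ℝ) := by
    nlinarith
  exact le_of_mul_le_mul_left h4 hNpos

/-- Given dense symmetric relations `Γ z` on tuples, one for each `z ∈ Z`, one can attach pairwise
disjoint tuples to the elements of `Z` and split `Z` into few singletons and monochromatic cyclic
sequences along which the tuple of each `z` is `Γ z`-related to that of its successor. -/
theorem exists_cyclic_partition {V α : Type*} [DecidableEq V] [Fintype α] [DecidableEq α]
    {m r : ℕ} (hα : 0 < Fintype.card α) (hr : 0 < r) (Z : Finset V) (col : V → Fin r)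
    (Γ : V → Finset ((Fin m → α) × (Fin m → α))) (hΓsymm : ∀ z f g, (f, g) ∈ Γ z → (g, f) ∈ Γ z)
    (ε : ℝ) (hε : 0 < ε) (hε1 : ε ≤ 1)
    (hΓ : ∀ z ∈ Z, ε * ((Fintype.card α : ℝ) ^ m) ^ 2 ≤ (Γ z).card)
    (hbudget : (m * (m * Z.card : ℕ) : ℝ) / Fintype.card α < ε ^ 4 / 32)
    (M₁ M₂ : ℕ) (hM₁ : 2 < ε * M₁) (hM₂ : 2 < ε ^ 2 / 4 * M₂) :
    ∃ (F : V → Fin m → α) (𝒬 : Finset (Finset V)),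
      (∀ z ∈ Z, ∃ z' ∈ Z, ∃ g, (F z, g) ∈ Γ z') ∧
      (∀ z ∈ Z, ∀ z' ∈ Z, z ≠ z' → ∀ i i', F z i ≠ F z' i') ∧
      (𝒬 : Set (Finset V)).PairwiseDisjoint id ∧ 𝒬.biUnion id = Z ∧
      𝒬.card ≤ r * M₁ + r * M₂ ∧
      ∀ A ∈ 𝒬, A.card = 1 ∨ A.Nonempty ∧ ∃ v, IsCyclicOrder A v ∧ (∀ j, col (v j) = col (v 0)) ∧
        ∀ j, (F (v j), F (v (j + 1))) ∈ Γ (v j) := by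
  classical
  have hNcard : (Fintype.card (Fin m → α) : ℝ) = (Fintype.card α : ℝ) ^ m := by simp
  have hMpos : (0 : ℝ) < Fintype.card α := by exact_mod_cast hα
  set N : ℝ := (Fintype.card α : ℝ) ^ m with hN
  have hNpos : 0 < N := by positivity
  have hτ : 0 < Fintype.card (Fin m → α) := by
    have : (0 : ℝ) < Fintype.card (Fin m → α) := by rw [hNcard]; exact hNpos
    exact_mod_cast this
  have hττ : (Fintype.card ((Fin m → α) × (Fin m → α)) : ℝ) = N ^ 2 := by
    rw [Fintype.card_prod, Nat.cast_mul, hNcard, sq]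
  obtain ⟨γ, hγ⟩ : ∃ γ : ℝ, γ = ε ^ 2 / 4 := ⟨_, rfl⟩
  have hγpos : 0 < γ := by rw [hγ]; positivity
  have hεsq : ε ^ 2 ≤ ε := by nlinarith
  have hγε : γ ≤ ε / 4 := by rw [hγ]; linarith
  have hγγ : γ ^ 2 / 2 = ε ^ 4 / 32 := by rw [hγ]; ring
  have hγ2 : γ ^ 2 / 2 ≤ γ := by nlinarith
  have hreq : ∀ Q : Finset (Fin m → α), γ ^ 2 / 2 * N ≤ Q.card →
      (m * (m * Z.card : ℕ) : ℝ) / Fintype.card α * N < Q.card := by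
    intro Q hQ
    refine lt_of_lt_of_le ?_ hQ
    rw [hγγ]
    exact mul_lt_mul_of_pos_right hbudget hNpos
  -- pair up elements whose relations have a large intersection
  obtain ⟨A, φ, hAZ, hφ, hleft⟩ := exists_matching
    (fun x y => col x = col y ∧ ε ^ 2 / 2 * N ^ 2 ≤ ((Γ x ∩ Γ y).card : ℝ)) (r * M₁) Z (by
      intro I hI hIc
      obtain ⟨i, hi, j, hj, hij, h⟩ := exists_large_inter_of_colouring hr col I Γ ε M₁
        (by rw [Fintype.card_prod]; exact Nat.mul_pos hτ hτ)
        (fun i hi => by rw [hττ]; exact hΓ i (hI hi)) hM₁ hε.le hIc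
      rw [hττ] at h
      exact ⟨i, hi, j, hj, hij, h⟩)
  have hφinj : Set.InjOn φ A := fun a ha b hb h => by
    rw [← (hφ a ha).2.2.1, h, (hφ b hb).2.2.1]
  set B := A.image φ with hB
  have hBZ : B ⊆ Z := by
    intro b hb
    obtain ⟨a, ha, rfl⟩ := Finset.mem_image.1 hb
    exact (hφ a ha).1
  have hAB : ∀ a ∈ A, a ∉ B := by
    intro a ha hb
    obtain ⟨a', ha', rfl⟩ := Finset.mem_image.1 hb
    exact (hφ a' ha').2.1 ha
  have hBcard : B.card = A.card := Finset.card_image_of_injOn hφinj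
  have hφB : ∀ b ∈ B, φ b ∈ A ∧ φ (φ b) = b := by
    intro b hb
    obtain ⟨a, ha, rfl⟩ := Finset.mem_image.1 hb
    rw [(hφ a ha).2.2.1]
    exact ⟨ha, rfl⟩
  -- choose the tuple joining the two elements of each pair
  obtain ⟨s, hs, hsdisj⟩ := exists_disjoint_choice hα (m * Z.card)
    (fun a => Finset.univ.filter fun f => γ * Fintype.card (Fin m → α) ≤
      ((Finset.univ.filter fun f' => (f, f') ∈ Γ a ∩ Γ (φ a)).card : ℝ)) ∅ A (by
      intro a ha
      refine hreq _ (le_trans ?_ (card_dense_fibres_ge hτ _ γ hγpos.le ?_))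
      · rw [hNcard]; gcongr
      · rw [hNcard, hγ]
        convert (hφ a ha).2.2.2.2 using 2
        ring) (by
      rw [Finset.card_empty, zero_add]
      exact Nat.mul_le_mul_left _ (Finset.card_le_card hAZ))
  let C : V → Finset (Fin m → α) :=
    fun a => Finset.univ.filter fun f' => (s a, f') ∈ Γ a ∩ Γ (φ a)
  have hC : ∀ a ∈ A, γ * N ≤ (C a).card := fun a ha => by
    have := (Finset.mem_filter.1 (hs a ha).1).2
    rwa [hNcard] at this
  -- arrange the pairs into cycles
  obtain ⟨𝒟, prev, h𝒟card, h𝒟disj, h𝒟un, hprev, h𝒟cyc⟩ := exists_cycle_cover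
    (fun a b => col a = col b ∧ γ ^ 2 / 2 * N ≤ ((C a ∩ C b).card : ℝ))
    (fun a b h => ⟨h.1.symm, by rw [Finset.inter_comm]; exact h.2⟩) (r * M₂) A
    (fun a ha => ⟨rfl, by
      rw [Finset.inter_self]
      refine le_trans ?_ (hC a ha)
      gcongr⟩) (by
      intro I hI hIc
      obtain ⟨i, hi, j, hj, hij, h⟩ := exists_large_inter_of_colouring hr col I C γ M₂
        hτ (fun i hi => by rw [hNcard]; exact hC i (hI hi)) (by rw [hγ]; exact hM₂) hγpos.le hIc.le
      rw [hNcard] at h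
      exact ⟨i, hi, j, hj, hij, h⟩)
  -- choose the remaining tuples
  obtain ⟨t, ht, htdisj⟩ := exists_disjoint_choice hα (m * Z.card)
    (fun z => if z ∈ A then C z ∩ C (prev z) else
      Finset.univ.filter fun f => ε / 2 * Fintype.card (Fin m → α) ≤
        ((Finset.univ.filter fun f' => (f, f') ∈ Γ z).card : ℝ))
    (A.biUnion fun a => Finset.univ.image (s a)) (Z \ B) (by
      intro z hz
      refine hreq _ ?_
      by_cases hzA : z ∈ A
      · rw [if_pos hzA]
        exact (hprev z hzA).2.2
      · rw [if_neg hzA]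
        refine le_trans ?_ (card_dense_fibres_ge hτ _ (ε / 2) (by positivity) ?_)
        · rw [hNcard]
          have : γ ^ 2 / 2 ≤ ε / 2 := by linarith
          gcongr
        · rw [hNcard]
          convert hΓ z (Finset.sdiff_subset hz) using 2
          ring) (by
      have h1 : (A.biUnion fun a => Finset.univ.image (s a)).card ≤ A.card * m :=
        Finset.card_biUnion_le_card_mul _ _ _ fun a _ => by
          simpa using Finset.card_image_le (s := Finset.univ) (f := s a)
      have h2 : (Z \ B).card + A.card = Z.card := by
        rw [← hBcard]
        exact Finset.card_sdiff_add_card_eq_card hBZ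
      rw [← h2]
      nlinarith)
  have htC : ∀ a ∈ A, t a ∈ C a ∧ t a ∈ C (prev a) := by
    intro a ha
    have := (ht a (Finset.mem_sdiff.2 ⟨hAZ ha, hAB a ha⟩)).1
    rw [if_pos ha] at this
    exact Finset.mem_inter.1 this
  have hCmem : ∀ a f, f ∈ C a → (s a, f) ∈ Γ a ∧ (s a, f) ∈ Γ (φ a) := by
    intro a f h
    exact Finset.mem_inter.1 (Finset.mem_filter.1 h).2
  let F : V → Fin m → α := fun z => if z ∈ B then s (φ z) else t z
  have hFA : ∀ a ∈ A, F a = t a := fun a ha => by simp [F, hAB a ha]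
  have hFφ : ∀ a ∈ A, F (φ a) = s a := fun a ha => by
    have : φ a ∈ B := Finset.mem_image_of_mem _ ha
    simp only [F, this, if_true, (hφ a ha).2.2.1]
  have hst : ∀ b ∈ B, ∀ z ∈ Z, z ∉ B → ∀ i i', s (φ b) i ≠ t z i' := by
    intro b hb z hz hzB i i' h
    refine (ht z (Finset.mem_sdiff.2 ⟨hz, hzB⟩)).2 i' ?_
    rw [← h]
    exact Finset.mem_biUnion.2 ⟨φ b, (hφB b hb).1, Finset.mem_image_of_mem _ (Finset.mem_univ _)⟩
  refine ⟨F, (Z \ (A ∪ B)).image (fun z => {z}) ∪ 𝒟.image (fun P => P ∪ P.image φ),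
    ?_, ?_, ?_, ?_, ?_, ?_⟩
  · intro z hz
    by_cases hzB : z ∈ B
    · obtain ⟨a, ha, rfl⟩ := Finset.mem_image.1 hzB
      rw [hFφ a ha]
      exact ⟨a, hAZ ha, t a, (hCmem _ _ (htC a ha).1).1⟩
    · by_cases hzA : z ∈ A
      · rw [hFA z hzA]
        exact ⟨z, hz, s z, hΓsymm _ _ _ (hCmem _ _ (htC z hzA).1).1⟩
      · have h := (ht z (Finset.mem_sdiff.2 ⟨hz, hzB⟩)).1
        rw [if_neg hzA] at h
        have h1 := (Finset.mem_filter.1 h).2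
        have h2 : (0 : ℝ) < ((Finset.univ.filter fun f' => (t z, f') ∈ Γ z).card : ℝ) :=
          lt_of_lt_of_le (by rw [hNcard]; positivity) h1
        obtain ⟨g, hg⟩ := Finset.card_pos.1 (by exact_mod_cast h2)
        refine ⟨z, hz, g, ?_⟩
        simp only [F, hzB, if_false]
        exact (Finset.mem_filter.1 hg).2
  · intro z hz z' hz' hne i i'
    by_cases hzB : z ∈ B <;> by_cases hzB' : z' ∈ B <;> simp only [F, hzB, hzB', if_true, if_false]
    · refine hsdisj _ (hφB z hzB).1 _ (hφB z' hzB').1 (fun h => hne ?_) i i'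
      rw [← (hφB z hzB).2, h, (hφB z' hzB').2]
    · exact hst z hzB z' hz' hzB' i i'
    · exact (hst z' hzB' z hz hzB i' i).symm
    · exact htdisj z (Finset.mem_sdiff.2 ⟨hz, hzB⟩) z' (Finset.mem_sdiff.2 ⟨hz', hzB'⟩) hne i i'
  · have h𝒟A : ∀ P ∈ 𝒟, P ⊆ A := fun P hP => by
      rw [← h𝒟un]; exact Finset.subset_biUnion_of_mem id hP
    have hPQ : ∀ P ∈ 𝒟, ∀ z, z ∈ P ∪ P.image φ → z ∈ A ∪ B := by
      intro P hP z hz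
      exact Finset.union_subset_union (h𝒟A P hP) (Finset.image_subset_image (h𝒟A P hP)) hz
    intro S hS S' hS' hne
    refine Finset.disjoint_left.2 fun z hz hz' => hne ?_
    simp only [Finset.coe_union, Finset.coe_image, Set.mem_union, Set.mem_image,
      Finset.mem_coe] at hS hS'
    simp only [id] at hz hz'
    rcases hS with ⟨x, hx, rfl⟩ | ⟨P, hP, rfl⟩ <;> rcases hS' with ⟨x', hx', rfl⟩ | ⟨P', hP', rfl⟩
    · rw [Finset.mem_singleton] at hz hz'
      rw [← hz, ← hz']
    · rw [Finset.mem_singleton] at hz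
      subst hz
      exact absurd (hPQ P' hP' _ hz') (Finset.mem_sdiff.1 hx).2
    · rw [Finset.mem_singleton] at hz'
      subst hz'
      exact absurd (hPQ P hP _ hz) (Finset.mem_sdiff.1 hx').2
    · have key : ∀ a, a ∈ P → a ∈ P' → P = P' := fun a h1 h2 => by
        by_contra hPP
        exact Finset.disjoint_left.1 (h𝒟disj hP hP' hPP) h1 h2
      suffices P = P' by rw [this]
      rcases Finset.mem_union.1 hz with h | h <;> rcases Finset.mem_union.1 hz' with h' | h'
      · exact key z h h'
      · exact absurd (Finset.image_subset_image (h𝒟A P' hP') h') (hAB z (h𝒟A P hP h))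
      · exact absurd (Finset.image_subset_image (h𝒟A P hP) h) (hAB z (h𝒟A P' hP' h'))
      · obtain ⟨a, ha, rfl⟩ := Finset.mem_image.1 h
        obtain ⟨a', ha', h''⟩ := Finset.mem_image.1 h'
        have := hφinj (h𝒟A P' hP' ha') (h𝒟A P hP ha) h''
        exact key a ha (this ▸ ha')
  · have h1 : (𝒟.image (fun P => P ∪ P.image φ)).biUnion id = A ∪ B := by
      ext z
      rw [hB, ← h𝒟un]
      simp only [Finset.mem_biUnion, Finset.mem_image, Finset.mem_union, id]
      constructor
      · rintro ⟨_, ⟨P, hP, rfl⟩, hz⟩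
        rcases Finset.mem_union.1 hz with h | h
        · exact Or.inl ⟨P, hP, h⟩
        · obtain ⟨a, ha, rfl⟩ := Finset.mem_image.1 h
          exact Or.inr ⟨a, ⟨P, hP, ha⟩, rfl⟩
      · rintro (⟨P, hP, h⟩ | ⟨a, ⟨P, hP, ha⟩, rfl⟩)
        · exact ⟨_, ⟨P, hP, rfl⟩, Finset.mem_union_left _ h⟩
        · exact ⟨_, ⟨P, hP, rfl⟩, Finset.mem_union_right _ (Finset.mem_image_of_mem _ ha)⟩
    have h2 : ((Z \ (A ∪ B)).image (fun z => ({z} : Finset V))).biUnion id = Z \ (A ∪ B) := by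
      ext z
      simp
    rw [Finset.union_biUnion, h1, h2]
    exact Finset.sdiff_union_of_subset (Finset.union_subset hAZ hBZ)
  · refine (Finset.card_union_le _ _).trans (add_le_add ?_ ?_)
    · exact Finset.card_image_le.trans hleft
    · exact Finset.card_image_le.trans h𝒟card
  · intro S hS
    rcases Finset.mem_union.1 hS with h | h
    · obtain ⟨x, -, rfl⟩ := Finset.mem_image.1 h
      exact Or.inl (Finset.card_singleton x)
    · obtain ⟨P, hP, rfl⟩ := Finset.mem_image.1 h
      obtain ⟨hPne, g, hg, hgprev⟩ := h𝒟cyc P hP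
      have hPA : P ⊆ A := by
        rw [← h𝒟un]; exact Finset.subset_biUnion_of_mem id hP
      have hgA : ∀ i, g i ∈ A := fun i => hPA (hg.mem hPne i)
      refine Or.inr ⟨hPne.mono Finset.subset_union_left, _, hg.interleave hPne
        (hφinj.mono hPA) (fun a ha h => (hφ a (hPA ha)).2.1 (hPA h)), ?_, ?_⟩
      · have hcolg : ∀ i, col (g i) = col (g 0) := by
          intro i
          induction i with
          | zero => rfl
          | succ i ih =>
            rw [← ih, ← hgprev i]
            exact (hprev _ (hgA (i + 1))).2.1
        intro j
        by_cases hj : j % 2 = 0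
        · simp [hj, hcolg]
        · simp only [hj, if_false]
          rw [← (hφ _ (hgA (j / 2))).2.2.2.1]
          simp [hcolg]
      · intro j
        by_cases hj : j % 2 = 0
        · rw [if_pos hj, if_neg (by omega), show (j + 1) / 2 = j / 2 by omega, hFA _ (hgA _),
            hFφ _ (hgA _)]
          exact hΓsymm _ _ _ (hCmem _ _ (htC _ (hgA _)).1).1
        · rw [if_neg hj, if_pos (by omega), show (j + 1) / 2 = j / 2 + 1 by omega, hFA _ (hgA _),
            hFφ _ (hgA _)]
          have := (htC _ (hgA (j / 2 + 1))).2
          rw [hgprev] at this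
          exact (hCmem _ _ this).2

theorem three_quarters_le_card_injective {α : Type*} [Fintype α] [DecidableEq α] (m : ℕ)
    (hα : 0 < Fintype.card α) (hm : 4 * (m * m) ≤ Fintype.card α) :
    3 / 4 * (Fintype.card α : ℝ) ^ m ≤
      ((Finset.univ.filter fun f : Fin m → α => Function.Injective f).card : ℝ) := by
  have hM : (0 : ℝ) < Fintype.card α := by exact_mod_cast hα
  have hcard : (Finset.univ.filter fun f : Fin m → α => Function.Injective f).card =
      (Fintype.card α).descFactorial m := by
    rw [← Fintype.card_subtype, Fintype.card_congr (Equiv.subtypeInjectiveEquivEmbedding _ _),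
      Fintype.card_embedding_eq, Fintype.card_fin]
  rw [hcard]
  set M := Fintype.card α with hMdef
  have hmM : m ≤ M := by nlinarith
  have h1 : ((M : ℝ) - m) ^ m ≤ (M.descFactorial m : ℝ) := by
    have h := (Nat.pow_le_pow_left (by omega : M - m ≤ M + 1 - m) m).trans
      (Nat.pow_sub_le_descFactorial M m)
    rw [← Nat.cast_sub hmM]
    exact_mod_cast h
  refine le_trans ?_ h1
  have hmM' : (4 : ℝ) * (m * m) ≤ M := by exact_mod_cast hm
  have hle : (m : ℝ) / M ≤ 1 := by
    rw [div_le_one hM]; exact_mod_cast hmM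
  have hb := one_add_mul_le_pow (a := -((m : ℝ) / M)) (by linarith) m
  have h2 : (m : ℝ) * (m / M) ≤ 1 / 4 := by
    rw [← mul_div_assoc, div_le_iff₀ hM]
    linarith
  calc 3 / 4 * (M : ℝ) ^ m ≤ (1 + -((m : ℝ) / M)) ^ m * (M : ℝ) ^ m := by
        gcongr
        linarith
    _ = ((M : ℝ) - m) ^ m := by
        rw [← mul_pow]; congr 1; field_simp; ring

/-- The `m`-tuples of distinct vertices of `X` which form an edge of colour `c` with `z`. -/
def colourLink {n r : ℕ} (χ : Finset (Fin n) → Fin r) (X : Finset (Fin n)) (m : ℕ) (c : Fin r)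
    (z : Fin n) : Finset (Fin m → X) :=
  Finset.univ.filter fun f => Function.Injective f ∧
    χ (insert z (Finset.univ.image fun i => (f i : Fin n))) = c

theorem exists_dense_colourLink {n r : ℕ} (hr : 0 < r) (χ : Finset (Fin n) → Fin r)
    (X : Finset (Fin n)) (m : ℕ) (hX : 0 < X.card) (hm : 4 * (m * m) ≤ X.card) (z : Fin n) :
    ∃ c, 3 / (4 * r : ℝ) * (X.card : ℝ) ^ m ≤ (colourLink χ X m c z).card := by
  have hinj := three_quarters_le_card_injective (α := X) m (by simpa using hX) (by simpa using hm)
  rw [Fintype.card_coe] at hinj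
  by_contra! hcon
  have hr' : (0 : ℝ) < r := by exact_mod_cast hr
  have hsum : (Finset.univ.filter fun f : Fin m → X => Function.Injective f).card =
      ∑ c, (colourLink χ X m c z).card := by
    rw [Finset.card_eq_sum_card_fiberwise
      (f := fun f : Fin m → X => χ (insert z (Finset.univ.image fun i => (f i : Fin n))))
      (t := Finset.univ) (fun _ _ => Finset.mem_univ _)]
    simp only [Finset.filter_filter, colourLink]
  have hlt : (∑ c, ((colourLink χ X m c z).card : ℝ)) <
      ∑ _c : Fin r, 3 / (4 * r : ℝ) * (X.card : ℝ) ^ m :=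
    Finset.sum_lt_sum_of_nonempty ⟨⟨0, hr⟩, Finset.mem_univ _⟩ fun c _ => hcon c
  rw [Finset.sum_const, Finset.card_univ, Fintype.card_fin, nsmul_eq_mul] at hlt
  have hsum' : (∑ c, ((colourLink χ X m c z).card : ℝ)) =
      ((Finset.univ.filter fun f : Fin m → X => Function.Injective f).card : ℝ) := by
    rw [hsum]; push_cast; rfl
  rw [hsum'] at hlt
  have : (r : ℝ) * (3 / (4 * r : ℝ) * (X.card : ℝ) ^ m) = 3 / 4 * (X.card : ℝ) ^ m := by
    field_simp
  linarith

/-- Each vertex of `A` together with its tuple. -/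
def withTuples {n m : ℕ} (F : Fin n → Fin m → Fin n) (A : Finset (Fin n)) : Finset (Fin n) :=
  A.biUnion fun z => insert z (Finset.univ.image (F z))

theorem mem_withTuples {n m : ℕ} {F : Fin n → Fin m → Fin n} {A : Finset (Fin n)} {x : Fin n} :
    x ∈ withTuples F A ↔ ∃ z ∈ A, x = z ∨ ∃ i, F z i = x := by
  simp [withTuples]

theorem monoTightCycle_withTuples {n m : ℕ} {β : Type*} (χ : Finset (Fin n) → β) (c : β)
    (A : Finset (Fin n)) (hA : A.Nonempty) (v : ℕ → Fin n) (hv : IsCyclicOrder A v)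
    (F : Fin n → Fin m → Fin n) (hinj : ∀ z ∈ A, Function.Injective (F z))
    (hdisj : ∀ z ∈ A, ∀ z' ∈ A, z ≠ z' → ∀ i i', F z i ≠ F z' i')
    (hF : ∀ z ∈ A, ∀ z' ∈ A, ∀ i, F z i ≠ z')
    (hmix : ∀ j, ∀ e : Fin m → Bool, χ (insert (v j)
      (Finset.univ.image fun i => cond (e i) (F (v j) i) (F (v (j + 1)) i))) = c) :
    MonoTightCycle (m + 1) χ (withTuples F A) := by
  have hvA := hv.mem hA
  let g : ℕ → Fin n := fun i =>
    if h : i % (m + 1) < m then F (v (i / (m + 1))) ⟨i % (m + 1), h⟩ else v (i / (m + 1))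
  have hdiv : ∀ J ρ, ρ < m + 1 → ((m + 1) * J + ρ) / (m + 1) = J := fun J ρ h => by
    rw [Nat.mul_add_div (by omega), Nat.div_eq_of_lt h, add_zero]
  have hmod : ∀ J ρ, ρ < m + 1 → ((m + 1) * J + ρ) % (m + 1) = ρ := fun J ρ h => by
    rw [Nat.mul_add_mod, Nat.mod_eq_of_lt h]
  have hgF : ∀ J (i : Fin m), g ((m + 1) * J + i) = F (v J) i := fun J i => by
    have hi : (i : ℕ) < m + 1 := by omega
    simp only [g, hdiv J i hi, hmod J i hi, i.2, dite_true]
  have hgv : ∀ J, g ((m + 1) * J + m) = v J := fun J => by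
    simp only [g, hdiv J m (by omega), hmod J m (by omega), lt_irrefl, dite_false]
  have hform : ∀ x, (∃ J, ∃ i : Fin m, x = (m + 1) * J + i) ∨ ∃ J, x = (m + 1) * J + m := by
    intro x
    have h1 := Nat.div_add_mod x (m + 1)
    have h2 : x % (m + 1) < m + 1 := Nat.mod_lt x (by omega)
    by_cases h : x % (m + 1) < m
    · exact Or.inl ⟨x / (m + 1), ⟨_, h⟩, h1.symm⟩
    · refine Or.inr ⟨x / (m + 1), ?_⟩
      rw [show x % (m + 1) = m by omega] at h1
      exact h1.symm
  have hlt : ∀ J ρ, (m + 1) * J + ρ < (m + 1) * A.card → J < A.card := fun J ρ h =>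
    Nat.lt_of_mul_lt_mul_left (lt_of_le_of_lt (Nat.le_add_right _ ρ) h)
  have hlt' : ∀ J ρ, J < A.card → ρ < m + 1 → (m + 1) * J + ρ < (m + 1) * A.card := by
    intro J ρ h h'
    calc (m + 1) * J + ρ < (m + 1) * J + (m + 1) := by omega
      _ = (m + 1) * (J + 1) := by ring
      _ ≤ _ := Nat.mul_le_mul_left _ h
  have hvinj : ∀ J J', J < A.card → J' < A.card → v J = v J' → J = J' :=
    fun J J' h h' he => hv.2.1 h h' he
  have hginj : Set.InjOn g (Set.Iio ((m + 1) * A.card)) := by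
    intro x hx y hy hxy
    simp only [Set.mem_Iio] at hx hy
    rcases hform x with ⟨J, i, rfl⟩ | ⟨J, rfl⟩ <;> rcases hform y with ⟨J', i', rfl⟩ | ⟨J', rfl⟩
    · rw [hgF, hgF] at hxy
      have hJ : v J = v J' := by
        by_contra hne
        exact hdisj _ (hvA J) _ (hvA J') hne i i' hxy
      obtain rfl := hvinj _ _ (hlt _ _ hx) (hlt _ _ hy) hJ
      rw [hinj _ (hvA J) hxy]
    · rw [hgF, hgv] at hxy
      exact absurd hxy (hF _ (hvA J) _ (hvA J') i)
    · rw [hgF, hgv] at hxy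
      exact absurd hxy.symm (hF _ (hvA J') _ (hvA J) i')
    · rw [hgv, hgv] at hxy
      rw [hvinj _ _ (hlt _ _ hx) (hlt _ _ hy) hxy]
  have himage : (Finset.range ((m + 1) * A.card)).image g = withTuples F A := by
    ext x
    rw [mem_withTuples]
    simp only [Finset.mem_image, Finset.mem_range]
    constructor
    · rintro ⟨y, -, rfl⟩
      rcases hform y with ⟨J, i, rfl⟩ | ⟨J, rfl⟩
      · exact ⟨v J, hvA J, Or.inr ⟨i, (hgF J i).symm⟩⟩
      · exact ⟨v J, hvA J, Or.inl (hgv J)⟩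
    · rintro ⟨z, hz, h⟩
      rw [← hv.2.2] at hz
      obtain ⟨J, hJ, rfl⟩ := Finset.mem_image.1 hz
      rw [Finset.mem_range] at hJ
      rcases h with rfl | ⟨i, rfl⟩
      · exact ⟨_, hlt' J m hJ (by omega), hgv J⟩
      · exact ⟨_, hlt' J i hJ (by omega), hgF J i⟩
  have hcard : (withTuples F A).card = (m + 1) * A.card := by
    rw [← himage, Finset.card_image_of_injOn (by simpa using hginj), Finset.card_range]
  refine Or.inr ⟨g, c, ?_, ?_, ?_, ?_⟩
  · intro x
    rw [hcard]
    rcases hform x with ⟨J, i, rfl⟩ | ⟨J, rfl⟩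
    · rw [show (m + 1) * J + i + (m + 1) * A.card = (m + 1) * (J + A.card) + i by ring, hgF, hgF,
        hv.1]
    · rw [show (m + 1) * J + m + (m + 1) * A.card = (m + 1) * (J + A.card) + m by ring, hgv, hgv,
        hv.1]
  · rwa [hcard]
  · rw [hcard, himage]
  · intro x
    obtain ⟨J, ρ, hρ, rfl⟩ : ∃ J ρ, ρ < m + 1 ∧ x = (m + 1) * J + ρ :=
      ⟨_, _, Nat.mod_lt x (Nat.succ_pos m), (Nat.div_add_mod x (m + 1)).symm⟩
    rw [← hmix J fun i => decide (ρ ≤ i)]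
    congr 1
    ext y
    simp only [Finset.mem_image, Finset.mem_range, Finset.mem_insert, Finset.mem_univ, true_and]
    constructor
    · rintro ⟨j, hj, rfl⟩
      rcases lt_trichotomy (ρ + j) m with h | h | h
      · refine Or.inr ⟨⟨ρ + j, h⟩, ?_⟩
        rw [add_assoc, hgF J ⟨ρ + j, h⟩]
        simp
      · left
        rw [add_assoc, h, hgv]
      · have h' : ρ + j - (m + 1) < m := by omega
        refine Or.inr ⟨⟨ρ + j - (m + 1), h'⟩, ?_⟩
        have : (m + 1) * J + ρ + j = (m + 1) * (J + 1) + (ρ + j - (m + 1)) := by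
          rw [mul_add]; omega
        rw [this, hgF (J + 1) ⟨ρ + j - (m + 1), h'⟩]
        have : ¬ ρ ≤ ρ + j - (m + 1) := by omega
        simp [this]
    · rintro (rfl | ⟨i, rfl⟩)
      · refine ⟨m - ρ, by omega, ?_⟩
        rw [show (m + 1) * J + ρ + (m - ρ) = (m + 1) * J + m by omega, hgv]
      · by_cases h : ρ ≤ i
        · refine ⟨i - ρ, by omega, ?_⟩
          rw [show (m + 1) * J + ρ + (i - ρ) = (m + 1) * J + i by omega, hgF]
          simp [h]
        · refine ⟨i + (m + 1) - ρ, by omega, ?_⟩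
          have : (m + 1) * J + ρ + (i + (m + 1) - ρ) = (m + 1) * (J + 1) + i := by
            rw [mul_add]; omega
          rw [this, hgF]
          simp [h]

theorem disjoint_withTuples {n m : ℕ} {F : Fin n → Fin m → Fin n} {X Z : Finset (Fin n)}
    (hXZ : Disjoint X Z) (hFX : ∀ z i, F z i ∈ X)
    (hdisj : ∀ z ∈ Z, ∀ z' ∈ Z, z ≠ z' → ∀ i i', F z i ≠ F z' i') {A B : Finset (Fin n)}
    (hA : A ⊆ Z) (hB : B ⊆ Z) (hAB : Disjoint A B) :
    Disjoint (withTuples F A) (withTuples F B) := by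
  have hne : ∀ z i, ∀ z' ∈ Z, F z i ≠ z' := fun z i z' hz' h =>
    Finset.disjoint_left.1 hXZ (hFX z i) (h ▸ hz')
  refine Finset.disjoint_left.2 fun x hx hx' => ?_
  obtain ⟨z, hz, h⟩ := mem_withTuples.1 hx
  obtain ⟨z', hz', h'⟩ := mem_withTuples.1 hx'
  have hzz : z ≠ z' := fun e => Finset.disjoint_left.1 hAB hz (e ▸ hz')
  rcases h with rfl | ⟨i, rfl⟩ <;> rcases h' with h' | ⟨i', h'⟩
  · exact hzz h'
  · exact hne _ _ _ (hA hz) h'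
  · exact hne _ _ _ (hB hz') h'
  · exact hdisj _ (hA hz) _ (hB hz') hzz i i' h'.symm

theorem card_withTuples_inter {n m : ℕ} {F : Fin n → Fin m → Fin n} {X Z : Finset (Fin n)}
    (hXZ : Disjoint X Z) (hFX : ∀ z i, F z i ∈ X)
    (hinj : ∀ z ∈ Z, Function.Injective (F z))
    (hdisj : ∀ z ∈ Z, ∀ z' ∈ Z, z ≠ z' → ∀ i i', F z i ≠ F z' i') :
    (withTuples F Z ∩ X).card = m * Z.card := by
  have h : withTuples F Z ∩ X = Z.biUnion fun z => Finset.univ.image (F z) := by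
    ext x
    rw [Finset.mem_inter, mem_withTuples]
    simp only [Finset.mem_biUnion, Finset.mem_image, Finset.mem_univ, true_and]
    constructor
    · rintro ⟨⟨z, hz, rfl | h⟩, hx⟩
      · exact absurd hz (Finset.disjoint_left.1 hXZ hx)
      · exact ⟨z, hz, h⟩
    · rintro ⟨z, hz, i, rfl⟩
      exact ⟨⟨z, hz, Or.inr ⟨i, rfl⟩⟩, hFX z i⟩
  rw [h, Finset.card_biUnion]
  · rw [Finset.sum_congr rfl fun z hz => Finset.card_image_of_injective _ (hinj z hz)]
    simp [mul_comm]
  · intro z hz z' hz' hne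
    refine Finset.disjoint_left.2 fun x hx hx' => ?_
    obtain ⟨i, -, rfl⟩ := Finset.mem_image.1 hx
    obtain ⟨i', -, h'⟩ := Finset.mem_image.1 hx'
    exact hdisj z hz z' hz' hne i i' h'.symm

theorem cover_Z_using_X (k r : ℕ) (hk : 3 ≤ k) :
    ∃ n₀ : ℕ, ∀ n : ℕ, n₀ ≤ n → ∀ χ : Finset (Fin n) → Fin r,
      ∀ X Z : Finset (Fin n), Disjoint X Z →
        2 ^ 5 * r * k * (2 * r) ^ (2 ^ (k + 1)) * Z.card ≤ X.card →
        ∃ 𝒞 : Finset (Finset (Fin n)),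
          (∀ C ∈ 𝒞, MonoTightCycle k χ C) ∧
          (𝒞 : Set (Finset (Fin n))).PairwiseDisjoint id ∧
          Z ⊆ 𝒞.biUnion id ∧
          𝒞.card ≤ 2 ^ 18 * r * (2 * r) ^ (5 * 2 ^ (k + 1)) ∧
          (𝒞.biUnion id ∩ X).card = (k - 1) * Z.card := by
  refine ⟨0, fun n _ χ X Z hXZ hX => ?_⟩
  obtain ⟨m, rfl⟩ : ∃ m, k = m + 1 := ⟨k - 1, by omega⟩
  rw [Nat.add_sub_cancel]
  rcases Z.eq_empty_or_nonempty with rfl | hZ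
  · exact ⟨∅, by simp⟩
  have hr : 0 < r := (χ ∅).pos
  have hZ1 : 1 ≤ Z.card := hZ.card_pos
  have hr' : (1 : ℝ) ≤ r := by exact_mod_cast hr
  have hZ1' : (1 : ℝ) ≤ Z.card := by exact_mod_cast hZ1
  have hpow : ∀ t, m + 1 ≤ (2 * r) ^ 2 ^ (m + 1 + 1) ∧ 1 ≤ (2 * r) ^ t := fun t => by
    refine ⟨?_, Nat.one_le_pow _ _ (by omega)⟩
    calc m + 1 ≤ 2 ^ (m + 1 + 1) := (Nat.lt_two_pow_self (n := m + 1)).le.trans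
          (Nat.pow_le_pow_right (by norm_num) (by omega))
      _ ≤ 2 ^ 2 ^ (m + 1 + 1) := Nat.lt_two_pow_self.le
      _ ≤ _ := Nat.pow_le_pow_left (by omega) _
  have hm : 4 * (m * m) ≤ X.card := by
    refine le_trans ?_ hX
    calc 4 * (m * m) ≤ 2 ^ 5 * 1 * (m + 1) * (m + 1) * 1 := by nlinarith
      _ ≤ _ := by
        gcongr
        · exact hr
        · exact (hpow 0).1
  have hXpos : 0 < X.card := by
    refine lt_of_lt_of_le ?_ hX
    have := (hpow (2 ^ (m + 1 + 1))).2
    positivity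
  have hXpos' : (0 : ℝ) < X.card := by exact_mod_cast hXpos
  choose col hcol using exists_dense_colourLink hr χ X m hXpos hm
  obtain ⟨d, hd⟩ : ∃ d : ℝ, d = 3 / (4 * r) := ⟨_, rfl⟩
  have hdpos : 0 < d := by rw [hd]; positivity
  have hd1 : d ≤ 1 := by rw [hd, div_le_one (by positivity)]; linarith
  have hdr : d * (2 * r) = 3 / 2 := by rw [hd]; field_simp; norm_num
  have hdrpow : ∀ t, d ^ t * (2 * r : ℝ) ^ t = (3 / 2) ^ t := fun t => by rw [← mul_pow, hdr]
  have hXcard : Fintype.card X = X.card := Fintype.card_coe X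
  obtain ⟨F, 𝒬, hFΓ, hFdisj, h𝒬disj, h𝒬un, h𝒬card, h𝒬⟩ :=
    exists_cyclic_partition (α := X) (m := m) (by rw [hXcard]; exact hXpos) hr Z col
    (fun z => boxPairs (colourLink χ X m (col z) z)) (fun _ _ _ h => boxPairs_symm h)
    (d ^ 2 ^ m) (by positivity) (pow_le_one₀ hdpos.le hd1)
    (by
      intro z _
      refine le_trans ?_ (card_boxPairs_ge (by rw [hXcard]; exact hXpos) m _)
      rw [hXcard]
      gcongr
      rw [le_div_iff₀ (by positivity), hd]
      exact hcol z)
    (by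
      rw [hXcard, div_lt_iff₀ hXpos', ← pow_mul,
        show 2 ^ m * 4 = 2 ^ (m + 1 + 1) by rw [pow_succ, pow_succ]; ring]
      set T := 2 ^ (m + 1 + 1) with hT
      have hXr : (2 : ℝ) ^ 5 * r * (m + 1) * (2 * r) ^ T * Z.card ≤ X.card := by
        exact_mod_cast hX
      have hmT : 2 * (m : ℝ) < (3 / 2 : ℝ) ^ T * 2 := by
        have h2 : 4 * ((m : ℝ) + 1) ≤ T := by
          have : 4 * (m + 1) ≤ T := by
            rw [hT, pow_succ, pow_succ]
            have := Nat.lt_two_pow_self (n := m)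
            omega
          exact_mod_cast this
        have := one_add_mul_le_pow (a := (1 / 2 : ℝ)) (by norm_num) T
        rw [show (1 : ℝ) + 1 / 2 = 3 / 2 by norm_num] at this
        linarith
      calc (m * (m * Z.card : ℕ) : ℝ) = m * (m * Z.card) := by push_cast; ring
        _ < (m + 1) * ((3 / 2 : ℝ) ^ T * Z.card) := by
            have hm0 : (0 : ℝ) ≤ m := by positivity
            have h1 : (m : ℝ) * Z.card < (3 / 2 : ℝ) ^ T * Z.card :=
              mul_lt_mul_of_pos_right (by linarith) (by linarith)
            nlinarith [mul_nonneg hm0 (by positivity : (0 : ℝ) ≤ Z.card)]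
        _ ≤ r * ((m + 1) * ((3 / 2 : ℝ) ^ T * Z.card)) :=
            le_mul_of_one_le_left (by positivity) hr'
        _ = d ^ T / 32 * ((2 : ℝ) ^ 5 * r * (m + 1) * (2 * r) ^ T * Z.card) := by
            rw [← hdrpow]; ring
        _ ≤ _ := by gcongr)
    (2 * (2 * r) ^ 2 ^ m) (8 * (2 * r) ^ 2 ^ (m + 1))
    (by
      have : (1 : ℝ) < (3 / 2) ^ 2 ^ m := one_lt_pow₀ (by norm_num) (by positivity)
      push_cast
      rw [show d ^ 2 ^ m * (2 * (2 * (r : ℝ)) ^ 2 ^ m) = 2 * (d ^ 2 ^ m * (2 * (r : ℝ)) ^ 2 ^ m)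
        by ring, hdrpow]
      linarith)
    (by
      have : (1 : ℝ) < (3 / 2) ^ 2 ^ (m + 1) := one_lt_pow₀ (by norm_num) (by positivity)
      push_cast
      rw [← pow_mul, ← pow_succ, show d ^ 2 ^ (m + 1) / 4 * (8 * (2 * (r : ℝ)) ^ 2 ^ (m + 1)) =
        2 * (d ^ 2 ^ (m + 1) * (2 * (r : ℝ)) ^ 2 ^ (m + 1)) by ring, hdrpow]
      linarith)
  have hlink : ∀ {z f}, f ∈ colourLink χ X m (col z) z → Function.Injective f ∧
      χ (insert z (Finset.univ.image fun i => (f i : Fin n))) = col z := fun h =>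
    (Finset.mem_filter.1 h).2
  let G : Fin n → Fin m → Fin n := fun z i => F z i
  have hGX : ∀ z i, G z i ∈ X := fun z i => (F z i).2
  have hGinj : ∀ z ∈ Z, Function.Injective (G z) := by
    intro z hz
    obtain ⟨z', -, g, hg⟩ := hFΓ z hz
    exact Subtype.val_injective.comp (hlink (mem_boxPairs.1 hg fun _ => true)).1
  have hGdisj : ∀ z ∈ Z, ∀ z' ∈ Z, z ≠ z' → ∀ i i', G z i ≠ G z' i' :=
    fun z hz z' hz' hne i i' h => hFdisj z hz z' hz' hne i i' (Subtype.ext h)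
  have h𝒬Z : ∀ A ∈ 𝒬, A ⊆ Z := fun A hA => by
    rw [← h𝒬un]; exact Finset.subset_biUnion_of_mem id hA
  have hun : (𝒬.image (withTuples G)).biUnion id = withTuples G Z := by
    ext x
    rw [Finset.image_biUnion]
    simp only [Finset.mem_biUnion, id, mem_withTuples, ← h𝒬un]
    constructor
    · rintro ⟨A, hA, z, hz, h⟩
      exact ⟨z, ⟨A, hA, hz⟩, h⟩
    · rintro ⟨z, ⟨A, hA, hz⟩, h⟩
      exact ⟨A, hA, z, hz, h⟩
  refine ⟨𝒬.image (withTuples G), ?_, ?_, ?_, ?_, ?_⟩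
  · intro C hC
    obtain ⟨A, hA, rfl⟩ := Finset.mem_image.1 hC
    rcases h𝒬 A hA with h | ⟨hne, v, hv, hvcol, hvF⟩
    · left
      refine (Finset.card_biUnion_le_card_mul _ _ (m + 1) fun z _ => ?_).trans (by rw [h, one_mul])
      refine (Finset.card_insert_le _ _).trans (Nat.succ_le_succ ?_)
      simpa using Finset.card_image_le (s := Finset.univ) (f := G z)
    · refine monoTightCycle_withTuples χ (col (v 0)) A hne v hv G
        (fun z hz => hGinj z (h𝒬Z A hA hz))
        (fun z hz z' hz' => hGdisj z (h𝒬Z A hA hz) z' (h𝒬Z A hA hz'))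
        (fun z _ z' hz' i h => Finset.disjoint_left.1 hXZ (hGX z i) (h ▸ h𝒬Z A hA hz')) ?_
      intro j e
      rw [← hvcol j, ← (hlink (mem_boxPairs.1 (hvF j) e)).2]
      congr 2
      refine Finset.image_congr fun i _ => ?_
      cases e i <;> rfl
  · rintro C hC D hD hne
    obtain ⟨A, hA, rfl⟩ := Finset.mem_image.1 (Finset.mem_coe.1 hC)
    obtain ⟨B, hB, rfl⟩ := Finset.mem_image.1 (Finset.mem_coe.1 hD)
    exact disjoint_withTuples hXZ hGX hGdisj (h𝒬Z A hA) (h𝒬Z B hB)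
      (h𝒬disj hA hB fun h => hne (h ▸ rfl))
  · rw [hun]
    exact fun z hz => mem_withTuples.2 ⟨z, hz, Or.inl rfl⟩
  · refine (Finset.card_image_le.trans h𝒬card).trans ?_
    have h2r : 0 < 2 * r := by omega
    have hT : 2 ^ (m + 1 + 1) = 4 * 2 ^ m := by rw [pow_succ, pow_succ]; ring
    have hT' : 2 ^ (m + 1) = 2 * 2 ^ m := by rw [pow_succ]; ring
    have h1 : (2 * r) ^ 2 ^ m ≤ (2 * r) ^ (5 * 2 ^ (m + 1 + 1)) :=
      Nat.pow_le_pow_right h2r (by omega)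
    have h2 : (2 * r) ^ 2 ^ (m + 1) ≤ (2 * r) ^ (5 * 2 ^ (m + 1 + 1)) :=
      Nat.pow_le_pow_right h2r (by omega)
    calc r * (2 * (2 * r) ^ 2 ^ m) + r * (8 * (2 * r) ^ 2 ^ (m + 1))
        ≤ r * (2 * (2 * r) ^ (5 * 2 ^ (m + 1 + 1))) +
          r * (8 * (2 * r) ^ (5 * 2 ^ (m + 1 + 1))) := by gcongr
      _ = 10 * (r * (2 * r) ^ (5 * 2 ^ (m + 1 + 1))) := by ring
      _ ≤ 2 ^ 18 * (r * (2 * r) ^ (5 * 2 ^ (m + 1 + 1))) := Nat.mul_le_mul_right _ (by norm_num)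
      _ = _ := by ring
  · rw [hun]
    exact card_withTuples_inter hXZ hGX hGinj hGdisj
end

section
/- For all c, μ, δ ∈ (0,1) with c + μ ≤ 1/8 there exists n₀ such that the following holds for all n ≥ n₀. Let G be a bipartite graph with vertex classes X = {x_1,…,x_n} and Y = {y_1,…,y_n} containing the perfect matching M = {x_i y_i : i ∈ [n]}, and suppose every x ∈ X has at least δn neighbours in Y. Then there exist disjoint subsets I⁺ and I⁻ of [n] with |I⁺| = |I⁻| = ⌊δn/4⌋ such that the following holds: for every vertex weighting ω of G satisfying (i) ω(y_i) = 1/2 for all i ∈ [n], (ii) ω(x_i) ∈ [1/2 − c, 1/2] for all i ∈ [n] \ I⁺, (iii) ω(x_i) ∈ [1/2, 1/2 + c] for all i ∈ [n] \ I⁻, and (iv) Σ_{i ∈ I⁺} (ω(x_i) − ω(y_i)) = Σ_{j ∈ I⁻} (ω(y_j) − ω(x_j)) < δ⁹n/8, the graph G has a fractional matching ω* of total weight at least Σ_{i ∈ [n]} ω(x_i) − μn such that 1/2 − c ≤ ω*(v) ≤ ω(v) for every vertex v, and every edge of nonzero weight has weight at least 1/8. -/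
section

open Finset Classical

/-- A nonempty set `R` of vertices of a digraph, closed up to a small set `Z`, which cannot be
split by removing few vertices. -/
theorem exists_robust_set {V : Type*} [Fintype V] [DecidableEq V] [Nonempty V]
    (A : V → V → Prop) (l : ℝ) (hl : 0 ≤ l) :
    ∃ Z R : Finset V, R.Nonempty ∧ (∀ v ∈ R, ∀ w, A v w → w ∈ R ∨ w ∈ Z) ∧
      (R.card : ℝ) + l * Z.card ≤ Fintype.card V ∧
      ∀ Z' S : Finset V, Disjoint S Z' → (S ∩ R).Nonempty →
        (∀ v ∈ S, ∀ w, A v w → w ∈ S ∨ w ∈ Z') → ((R \ S).card : ℝ) ≤ l * Z'.card := by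
  let Q : Finset (Finset V × Finset V) := univ.filter fun p =>
    p.2.Nonempty ∧ Disjoint p.2 p.1 ∧ ∀ v ∈ p.2, ∀ w, A v w → w ∈ p.2 ∨ w ∈ p.1
  have h0 : ((∅, univ) : Finset V × Finset V) ∈ Q := by simp [Q, univ_nonempty]
  obtain ⟨⟨Z, R⟩, hm, hmin⟩ :=
    exists_min_image Q (fun p => (p.2.card : ℝ) + l * p.1.card) ⟨_, h0⟩
  obtain ⟨hne, hd, hcl⟩ : R.Nonempty ∧ Disjoint R Z ∧ ∀ v ∈ R, ∀ w, A v w → w ∈ R ∨ w ∈ Z := by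
    simpa [Q] using hm
  refine ⟨Z, R, hne, hcl, by simpa using hmin _ h0, fun Z' S hSZ hSR hS => ?_⟩
  have hmem : ((Z ∪ Z', S ∩ R) : Finset V × Finset V) ∈ Q := by
    simp only [Q, mem_filter, mem_univ, true_and]
    refine ⟨hSR, ?_, ?_⟩
    · rw [disjoint_union_right]
      exact ⟨hd.mono_left inter_subset_right, hSZ.mono_left inter_subset_left⟩
    · intro v hv w hw
      have := hS v (mem_inter.1 hv).1 w hw
      have := hcl v (mem_inter.1 hv).2 w hw
      simp only [mem_inter, mem_union]
      tauto
  have h1 := hmin _ hmem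
  have h2 : ((R \ S).card : ℝ) + (S ∩ R).card = R.card := by
    rw [inter_comm]; exact_mod_cast card_sdiff_add_card_inter R S
  have h3 : ((Z ∪ Z').card : ℝ) ≤ Z.card + Z'.card := by exact_mod_cast card_union_le _ _
  have h4 := mul_le_mul_of_nonneg_left h3 hl
  simp only at h1
  linarith

/-- Hall's theorem in the form of a linking from `U` to `W`: a reflexive relation contains a
bijection from the complement of `W` onto the complement of `U` provided that `U` cannot be
separated from `W` by fewer than `#U` vertices. -/
theorem exists_linking {V : Type*} [Fintype V] [DecidableEq V] (A : V → V → Prop)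
    (hA : ∀ v, A v v)
    (U W : Finset V) (hUW : U.card = W.card)
    (hsep : ∀ Z S : Finset V, Disjoint S Z → (S ∩ U).Nonempty → Z.card < U.card →
      (∀ v ∈ S, ∀ w, A v w → w ∈ S ∨ w ∈ Z) → ∃ w ∈ W, w ∈ S) :
    ∃ τ : Equiv.Perm V, (∀ v, τ v ∈ U ↔ v ∈ W) ∧ ∀ v ∉ W, A v (τ v) := by
  let t : V → Finset V := fun v => if v ∈ W then U else univ.filter fun w => w ∉ U ∧ A v w
  have hall : ∀ S : Finset V, S.card ≤ (S.biUnion t).card := by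
    intro S
    set T : Finset V := (S \ W).biUnion t with hT
    have hTU : Disjoint T U := by
      rw [disjoint_left]
      simp +contextual [hT, t]
    have hST : (S \ W).card ≤ T.card := by
      by_contra! hlt
      set S' := S \ W with hS'
      have hsub : S' \ U ⊆ T := by
        intro v hv
        rw [mem_sdiff] at hv
        refine mem_biUnion.2 ⟨v, hv.1, ?_⟩
        simp [t, (mem_sdiff.1 hv.1).2, hv.2, hA]
      have hc1 := card_sdiff_add_card_inter S' U
      have hc2 := card_sdiff_add_card_eq_card hsub
      have hc3 := card_sdiff_add_card_inter U S'
      have hc4 : ((T \ (S' \ U)) ∪ (U \ S')).card ≤ _ := card_union_le _ _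
      rw [inter_comm] at hc3
      obtain ⟨w, hw, hwS⟩ := hsep ((T \ (S' \ U)) ∪ (U \ S')) S' (by
          rw [disjoint_left]
          intro a ha
          have := fun h : a ∈ T => disjoint_left.1 hTU h
          simp only [mem_union, mem_sdiff]
          tauto) (card_pos.1 (by omega)) (by omega) (by
          intro v hv w hw
          by_cases hwS : w ∈ S'
          · exact Or.inl hwS
          · right
            by_cases hwU : w ∈ U
            · simp [hwS, hwU]
            · have : w ∈ T := mem_biUnion.2 ⟨v, hv, by simp [t, (mem_sdiff.1 hv).2, hwU, hw]⟩
              simp [hwS, this])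
      exact (mem_sdiff.1 hwS).2 hw
    have hTsub : T ⊆ S.biUnion t := biUnion_subset_biUnion_of_subset_left _ sdiff_subset
    have hc := card_sdiff_add_card_inter S W
    rcases (S ∩ W).eq_empty_or_nonempty with he | ⟨v, hv⟩
    · rw [he, card_empty] at hc
      have := card_le_card hTsub
      omega
    · have hU : U ⊆ S.biUnion t := by
        intro u hu
        exact mem_biUnion.2 ⟨v, (mem_inter.1 hv).1, by simp [t, (mem_inter.1 hv).2, hu]⟩
      have h1 := card_le_card (union_subset hTsub hU)
      rw [card_union_of_disjoint hTU] at h1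
      have h2 := card_le_card (inter_subset_right : S ∩ W ⊆ W)
      omega
  obtain ⟨f, hf, hft⟩ := (all_card_le_biUnion_card_iff_exists_injective t).1 hall
  refine ⟨Equiv.ofBijective f (Finite.injective_iff_bijective.1 hf), fun v => ?_, fun v hv => ?_⟩
  · have := hft v
    by_cases hv : v ∈ W <;> simp_all [t]
  · have := hft v
    simp_all [t]

/-- Some translate of the integer lattice is crossed at most as often as on average. -/
theorem exists_sum_floor_le {ι : Type*} (s : Finset ι) (a b : ι → ℝ) :
    ∃ θ : ℝ, ((∑ i ∈ s, (⌊b i + θ⌋ - ⌊a i + θ⌋) : ℤ) : ℝ) ≤ ∑ i ∈ s, (b i - a i) := by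
  by_contra! h
  have hint : ∀ x : ℝ,
      IntervalIntegrable (fun θ : ℝ => Int.fract (x + θ)) MeasureTheory.volume 0 1 := by
    intro x
    rw [intervalIntegrable_iff]
    refine MeasureTheory.IntegrableOn.of_bound (C := 1) (by simp) ?_ ?_
    · exact (measurable_fract.comp (measurable_const_add x)).aestronglyMeasurable
    · refine Filter.Eventually.of_forall fun θ => ?_
      rw [Real.norm_of_nonneg (Int.fract_nonneg _)]
      exact (Int.fract_lt_one _).le
  have hconst : ∀ x : ℝ, ∫ θ in (0 : ℝ)..1, Int.fract (x + θ) = ∫ θ in (0 : ℝ)..1, Int.fract θ := by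
    intro x
    have hp : Function.Periodic (Int.fract : ℝ → ℝ) 1 := fun y => Int.fract_add_one y
    rw [intervalIntegral.integral_comp_add_left (fun y => Int.fract y) x]
    simpa using hp.intervalIntegral_add_eq x 0
  have hpos : ∀ θ : ℝ, 0 < ∑ i ∈ s, (Int.fract (a i + θ) - Int.fract (b i + θ)) := by
    intro θ
    have := h θ
    push_cast at this
    rw [← sub_pos, ← sum_sub_distrib] at this
    refine this.trans_eq (sum_congr rfl fun i _ => ?_)
    simp only [Int.fract]
    ring
  have hI : IntervalIntegrable (fun θ : ℝ => ∑ i ∈ s, (Int.fract (a i + θ) - Int.fract (b i + θ)))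
      MeasureTheory.volume 0 1 := by
    have := IntervalIntegrable.sum s (fun i _ => (hint (a i)).sub (hint (b i)))
    simpa [Finset.sum_fn] using this
  have h1 := intervalIntegral.intervalIntegral_pos_of_pos hI hpos one_pos
  rw [intervalIntegral.integral_finsetSum fun i _ => (hint (a i)).sub (hint (b i))] at h1
  simp [intervalIntegral.integral_sub (hint _) (hint _), hconst] at h1

/-- A set with large out-degrees contains a cycle through all the out-neighbours of one of its
vertices; a function of zero sum on this cycle is a coboundary. -/
theorem exists_cycle {V : Type*} [Fintype V] (A : V → V → Prop) (hA : ∀ v, A v v)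
    (K : Finset V) (hK : K.Nonempty) :
    ∃ C : Finset V, ∃ π : Equiv.Perm V, (∃ v ∈ K, ∀ w ∈ K, A v w → w ∈ C) ∧
      (∀ v, A v (π v)) ∧ C ⊆ K ∧
      ∀ s : V → ℝ, (∀ v ∉ C, s v = 0) → ∑ v ∈ C, s v = 0 →
        ∃ h : V → ℝ, ∀ v, h (π v) = h v + s v := by
  let P : ℕ → Prop := fun m => ∃ p : ℕ → V, Set.InjOn p (Set.Iic m) ∧ (∀ k ≤ m, p k ∈ K) ∧
    ∀ k < m, A (p k) (p (k + 1))
  obtain ⟨v₀, hv₀⟩ := hK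
  have hP0 : P 0 := ⟨fun _ => v₀, by
    intro a ha b hb _
    simp at ha hb
    omega, fun _ _ => hv₀, by simp⟩
  have hPb : ∀ m, P m → m ≤ Fintype.card V := by
    rintro m ⟨p, hp, -, -⟩
    have := Finset.card_le_card_of_injOn (s := Finset.Iic m) (t := univ) p (by simp)
      (by simpa using hp)
    simp at this
    omega
  let m := Nat.findGreatest P (Fintype.card V)
  have hm : P m := Nat.findGreatest_spec (Nat.zero_le _) hP0
  have hmax : ¬ P (m + 1) := fun h => by
    have := Nat.le_findGreatest (hPb _ h) h
    change m + 1 ≤ m at this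
    omega
  obtain ⟨p, hinj, hpK, hpA⟩ := hm
  have hout : ∀ w ∈ K, A (p m) w → ∃ k ≤ m, p k = w := by
    intro w hw hAw
    by_contra! hno
    refine hmax ⟨fun k => if k ≤ m then p k else w, ?_, ?_, ?_⟩
    · intro a ha b hb hab
      simp only [Set.mem_Iic] at ha hb
      by_cases h1 : a ≤ m <;> by_cases h2 : b ≤ m <;> simp only [h1, h2, if_true, if_false] at hab
      · exact hinj h1 h2 hab
      · exact absurd hab (hno a h1)
      · exact absurd hab.symm (hno b h2)
      · omega
    · intro k _
      by_cases h1 : k ≤ m <;> simp [h1, hw, hpK]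
    · intro k hk
      rcases Nat.lt_succ_iff_lt_or_eq.1 hk with h1 | h1
      · simpa [h1.le, Nat.succ_le_of_lt h1] using hpA k h1
      · subst h1
        simpa using hAw
  have hex : ∃ k, A (p m) (p k) := ⟨m, hA _⟩
  let j := Nat.find hex
  have hj : A (p m) (p j) := Nat.find_spec hex
  have hjm : j ≤ m := Nat.find_min' hex (hA _)
  let c : ℕ → V := fun k => p (j + k)
  let L := m - j + 1
  have hcinj : ∀ a < L, ∀ b < L, c a = c b → a = b := by
    intro a ha b hb hab
    have := hinj (show j + a ∈ Set.Iic m by simp; omega) (show j + b ∈ Set.Iic m by simp; omega) hab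
    omega
  let l : List V := (List.range L).map c
  have hlen : l.length = L := by simp [l]
  have hget : ∀ k (hk : k < l.length), l[k] = c k := by simp [l]
  have hnd : l.Nodup := by
    refine List.Nodup.map_on ?_ List.nodup_range
    intro a ha b hb
    exact hcinj a (List.mem_range.1 ha) b (List.mem_range.1 hb)
  have hmem : ∀ v, v ∈ l ↔ ∃ k < L, c k = v := by simp [l]
  have hπ : ∀ k < L, l.formPerm (c k) = c ((k + 1) % L) := by
    intro k hk
    have := List.formPerm_apply_getElem l hnd k (by omega)
    simpa [hget, hlen] using this
  have hidx : ∀ k < L, l.idxOf (c k) = k := by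
    intro k hk
    rw [← hget k (by omega), hnd.idxOf_getElem]
  refine ⟨l.toFinset, l.formPerm, ⟨p m, hpK m le_rfl, ?_⟩, ?_, ?_, ?_⟩
  · intro w hw hAw
    obtain ⟨k, hk, rfl⟩ := hout w hw hAw
    have : j ≤ k := Nat.find_min' hex hAw
    rw [List.mem_toFinset, hmem]
    exact ⟨k - j, by omega, by simp [c, this]⟩
  · intro v
    by_cases hv : v ∈ l
    · obtain ⟨k, hk, rfl⟩ := (hmem v).1 hv
      rw [hπ k hk]
      rcases Nat.lt_or_ge (k + 1) L with h1 | h1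
      · rw [Nat.mod_eq_of_lt h1]
        exact hpA (j + k) (by omega)
      · have hkL : k + 1 = L := by omega
        have : j + k = m := by omega
        rw [hkL, Nat.mod_self]
        simpa [c, this] using hj
    · rw [List.formPerm_apply_of_notMem hv]
      exact hA v
  · intro v hv
    obtain ⟨k, hk, rfl⟩ := (hmem v).1 (List.mem_toFinset.1 hv)
    exact hpK _ (by omega)
  · intro s hs hsum
    refine ⟨fun v => ∑ k ∈ range (l.idxOf v), s (c k), fun v => ?_⟩
    by_cases hv : v ∈ l
    · obtain ⟨k, hk, rfl⟩ := (hmem v).1 hv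
      beta_reduce
      rw [hπ k hk, hidx k hk, ← sum_range_succ]
      rcases Nat.lt_or_ge (k + 1) L with h1 | h1
      · rw [Nat.mod_eq_of_lt h1, hidx _ h1]
      · have hkL : k + 1 = L := by omega
        rw [hkL, Nat.mod_self, hidx 0 (by omega), range_zero, sum_empty, ← hsum]
        have : l.toFinset = (range L).image c := by
          ext v
          simp [hmem]
        rw [this, sum_image]
        intro a ha b hb
        exact hcinj a (by simpa using ha) b (by simpa using hb)
    · rw [List.formPerm_apply_of_notMem hv, hs v (by simpa using hv), add_zero]

/-- Double counting of the pairs of a relation between two finite sets. -/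
theorem sum_card_filter_comm {V : Type*} (A : V → V → Prop) (S T : Finset V) :
    ∑ v ∈ S, ((T.filter fun w => A v w).card : ℝ) = ∑ w ∈ T, ((S.filter fun v => A v w).card : ℝ) := by
  exact_mod_cast sum_card_bipartiteAbove_eq_sum_card_bipartiteBelow A

/-- A digraph whose out-degrees are large has a large part in which every vertex still has many
out-neighbours, many of which moreover have in-degree at least `t`. -/
theorem exists_core {V : Type*} (A : V → V → Prop) (R : Finset V) (hR : R.Nonempty)
    {δ N z t : ℝ} (hδ0 : 0 < δ) (hδ1 : δ < 1) (hN : 0 < N) (hz : 0 ≤ z)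
    (hout : ∀ v ∈ R, δ * N - z ≤ (R.filter fun w => A v w).card)
    (hRz : R.card + (4 / δ - 3) * z ≤ N) (ht0 : 0 ≤ t)
    (ht1 : t ≤ δ ^ 8 * (4 - 3 * δ) * N) (ht2 : t ≤ (1 - 3 * δ / 4) * N) :
    ∃ K ⊆ R, K.Nonempty ∧
      (∀ v ∈ K, δ * N / 2 ≤ (K.filter fun w => A v w).card) ∧
      ∀ v ∈ K, δ * N / 4 ≤
        (K.filter fun w => A v w ∧ t ≤ (R.filter fun u => A u w).card).card := by
  set l : ℝ := 4 / δ - 3 with hl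
  have hlδ : l * δ = 4 - 3 * δ := by
    rw [hl]
    field_simp
  have hl1 : 1 ≤ l := by nlinarith
  set L := R.filter fun w => ((R.filter fun u => A u w).card : ℝ) < t with hL
  have hrpos : (0 : ℝ) < R.card := by exact_mod_cast hR.card_pos
  obtain ⟨v₀, hv₀⟩ := hR
  have hr : δ * N - z ≤ R.card := (hout v₀ hv₀).trans (by exact_mod_cast card_filter_le _ _)
  have hzδ : z ≤ δ * N / 4 := by
    have h1 : (l - 1) * z ≤ (1 - δ) * N := by linarith
    have h2 : (l - 1) * δ = 4 * (1 - δ) := by linarith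
    have h3 : (1 - δ) * (4 * z) ≤ (1 - δ) * (δ * N) := by
      calc (1 - δ) * (4 * z) = ((l - 1) * z) * δ := by linear_combination (-z) * h2
        _ ≤ ((1 - δ) * N) * δ := mul_le_mul_of_nonneg_right h1 hδ0.le
        _ = _ := by ring
    have := le_of_mul_le_mul_left h3 (by linarith)
    linarith
  have hlz : z ≤ l * z := le_mul_of_one_le_left hz hl1
  have hLR : (L.card : ℝ) ≤ R.card := by exact_mod_cast card_filter_le _ _
  have hLr : (L.card : ℝ) ≤ R.card - δ * N + z + t := by
    have h1 : (R.card : ℝ) * (δ * N - z) ≤ ∑ v ∈ R, ((R.filter fun w => A v w).card : ℝ) := by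
      rw [← nsmul_eq_mul]
      exact card_nsmul_le_sum _ _ _ hout
    have h2 : ∑ w ∈ R, ((R.filter fun v => A v w).card : ℝ) ≤
        ∑ w ∈ R, ((if w ∈ L then t - R.card else 0) + R.card) := by
      refine sum_le_sum fun w hw => ?_
      split_ifs with h
      · have := (mem_filter.1 h).2
        linarith
      · rw [zero_add]
        exact_mod_cast card_filter_le _ _
    have h3 : R ∩ L = L := inter_eq_right.2 (filter_subset _ _)
    rw [sum_card_filter_comm] at h1
    rw [sum_add_distrib, sum_ite_mem, h3, sum_const, sum_const, nsmul_eq_mul, nsmul_eq_mul] at h2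
    have h4 : (L.card : ℝ) * t ≤ R.card * t := mul_le_mul_of_nonneg_right hLR ht0
    have h5 : (R.card : ℝ) * L.card ≤ R.card * (R.card - δ * N + z + t) := by linarith
    exact le_of_mul_le_mul_left h5 hrpos
  have key : ∀ K ⊆ R, ∀ v, ((K.filter fun w => A v w).card : ℝ) ≤
      (K.filter fun w => A v w ∧ t ≤ (R.filter fun u => A u w).card).card +
        (L.filter fun w => A v w).card := by
    intro K hK v
    rw [← Nat.cast_add, Nat.cast_le]
    refine le_trans (card_le_card ?_) (card_union_le _ _)
    intro w hw
    rw [mem_filter] at hw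
    simp only [mem_union, mem_filter, hL]
    rcases le_or_gt t ((R.filter fun u => A u w).card : ℝ) with h | h
    · exact Or.inl ⟨hw.1, hw.2, h⟩
    · exact Or.inr ⟨⟨hK hw.1, h⟩, hw.2⟩
  rcases le_or_gt δ (3 / 5) with hδ | hδ
  · have hLt : (L.card : ℝ) * t ≤ δ ^ 2 * N ^ 2 / 16 := by
      have hL1 : (L.card : ℝ) ≤ N := by linarith
      have hL2 : (L.card : ℝ) ≤ (1 - δ) * N + t := by linarith
      rcases le_or_gt δ (1 / 2) with hδ' | hδ'
      · have h6 : δ ^ 6 ≤ 1 / 64 := (pow_le_pow_left₀ hδ0.le hδ' 6).trans (by norm_num)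
        have h7 : t ≤ δ ^ 2 / 16 * N := by
          refine ht1.trans (mul_le_mul_of_nonneg_right ?_ hN.le)
          calc δ ^ 8 * (4 - 3 * δ) = δ ^ 2 * (δ ^ 6 * (4 - 3 * δ)) := by ring
            _ ≤ δ ^ 2 * (1 / 64 * 4) := by gcongr <;> linarith
            _ = _ := by ring
        calc (L.card : ℝ) * t ≤ N * (δ ^ 2 / 16 * N) := by gcongr
          _ = _ := by ring
      · have h5 : δ ^ 5 ≤ 243 / 3125 := (pow_le_pow_left₀ hδ0.le hδ 5).trans (by norm_num)
        have h7 : t ≤ δ ^ 2 * (11 / 100) * N := by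
          refine ht1.trans (mul_le_mul_of_nonneg_right ?_ hN.le)
          calc δ ^ 8 * (4 - 3 * δ) = δ ^ 2 * (δ ^ 5 * (4 * δ - 3 * δ ^ 2)) := by ring
            _ ≤ δ ^ 2 * (243 / 3125 * (4 / 3)) := by
              gcongr
              · nlinarith
              · nlinarith [sq_nonneg (3 * δ - 2)]
            _ ≤ _ := by
              gcongr
              norm_num
        have h8 : t ≤ 4 / 100 * N := by
          refine h7.trans (mul_le_mul_of_nonneg_right ?_ hN.le)
          nlinarith
        have h9 : (L.card : ℝ) ≤ 54 / 100 * N := by nlinarith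
        calc (L.card : ℝ) * t ≤ 54 / 100 * N * (δ ^ 2 * (11 / 100) * N) := by gcongr
          _ ≤ _ := by nlinarith [mul_pos (pow_pos hδ0 2) (pow_pos hN 2)]
    set B := R.filter fun v => δ * N / 4 < ((L.filter fun w => A v w).card : ℝ) with hB
    have hBc : (B.card : ℝ) ≤ δ * N / 4 := by
      have h1 : (B.card : ℝ) * (δ * N / 4) ≤ ∑ v ∈ B, ((L.filter fun w => A v w).card : ℝ) := by
        rw [← nsmul_eq_mul]
        exact card_nsmul_le_sum _ _ _ fun v hv => (mem_filter.1 hv).2.le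
      have h2 : ∑ v ∈ B, ((L.filter fun w => A v w).card : ℝ) ≤ (L.card : ℝ) * t := by
        rw [sum_card_filter_comm, ← nsmul_eq_mul]
        refine sum_le_card_nsmul _ _ _ fun w hw => le_trans ?_ (mem_filter.1 hw).2.le
        exact_mod_cast card_le_card (filter_subset_filter _ (filter_subset _ _))
      have h3 : (B.card : ℝ) * (δ * N / 4) ≤ (δ * N / 4) * (δ * N / 4) := by linarith
      exact le_of_mul_le_mul_right h3 (by positivity)
    have hK1 : ∀ v ∈ R, δ * N / 2 ≤ (((R \ B).filter fun w => A v w).card : ℝ) := by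
      intro v hv
      have h1 : (R.filter fun w => A v w).card ≤ ((R \ B).filter fun w => A v w).card + B.card := by
        refine le_trans (card_le_card ?_) (card_union_le _ _)
        intro w hw
        simp only [mem_filter, mem_union, mem_sdiff] at hw ⊢
        tauto
      have h2 : ((R.filter fun w => A v w).card : ℝ) ≤
          ((R \ B).filter fun w => A v w).card + B.card := by exact_mod_cast h1
      linarith [hout v hv]
    refine ⟨R \ B, sdiff_subset, ?_, fun v hv => hK1 v (mem_sdiff.1 hv).1, fun v hv => ?_⟩
    · have h1 := hK1 v₀ hv₀
      have h2 : (0 : ℝ) < (((R \ B).filter fun w => A v₀ w).card : ℝ) :=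
        lt_of_lt_of_le (by positivity) h1
      exact (card_pos.1 (by exact_mod_cast h2)).mono (filter_subset _ _)
    · have h1 := hK1 v (mem_sdiff.1 hv).1
      have h2 : ((L.filter fun w => A v w).card : ℝ) ≤ δ * N / 4 := by
        by_contra! h
        exact (mem_sdiff.1 hv).2 (mem_filter.2 ⟨(mem_sdiff.1 hv).1, h⟩)
      have h3 := key (R \ B) sdiff_subset v
      linarith
  · have hLz : (L.card : ℝ) + z ≤ 3 / 4 * (δ * N) := by
      rcases le_or_gt δ (4 / 5) with hδ' | hδ'
      · have hl2 : 2 ≤ l := by nlinarith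
        have hlz' : 2 * z ≤ l * z := mul_le_mul_of_nonneg_right hl2 hz
        have h2 : δ ^ 2 ≤ 7 / 5 * δ - 12 / 25 := by nlinarith
        have h4 : δ ^ 4 ≤ δ ^ 2 - 144 / 625 := by nlinarith
        have h8 : δ ^ 8 ≤ 337 / 625 * δ ^ 4 - 81 / 625 * (256 / 625) := by
          have ha : 81 / 625 ≤ δ ^ 4 := (by norm_num : (81 / 625 : ℝ) ≤ (3 / 5) ^ 4).trans
            (pow_le_pow_left₀ (by norm_num) hδ.le 4)
          have hb : δ ^ 4 ≤ 256 / 625 := (pow_le_pow_left₀ hδ0.le hδ' 4).trans (by norm_num)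
          nlinarith
        have h9 : δ ^ 8 * (4 - 3 * δ) ≤ 7 / 4 * δ - 1 := by
          have h10 : δ ^ 8 ≤ 756 / 1000 * δ - 436 / 1000 := by linarith
          calc δ ^ 8 * (4 - 3 * δ) ≤ (756 / 1000 * δ - 436 / 1000) * (4 - 3 * δ) :=
                mul_le_mul_of_nonneg_right h10 (by linarith)
            _ ≤ _ := by nlinarith
        have h11 := mul_le_mul_of_nonneg_right h9 hN.le
        linarith
      · have h1 : (2 - l) * z ≤ (5 / 4 * δ - 1) * N := by
          have hl2 : 0 ≤ 2 - l := by nlinarith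
          calc (2 - l) * z ≤ (2 - l) * (δ * N / 4) := mul_le_mul_of_nonneg_left hzδ hl2
            _ = _ := by linear_combination (-N / 4) * hlδ
        have h2 := mul_lt_mul_of_pos_right hδ' hN
        linarith
    refine ⟨R, Subset.rfl, ⟨v₀, hv₀⟩, fun v hv => ?_, fun v hv => ?_⟩
    · have := hout v hv
      have := mul_pos hδ0 hN
      linarith
    · have h1 := key R Subset.rfl v
      have h2 : ((L.filter fun w => A v w).card : ℝ) ≤ L.card := by
        exact_mod_cast card_filter_le _ _
      linarith [hout v hv]

/-- The sets `Ip` and `Im` lie on a common cycle, and no vertex of `Ip` can be separated from a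
vertex of `Im` by few vertices. -/
theorem exists_linked_sets {V : Type*} [Fintype V] [DecidableEq V] (A : V → V → Prop)
    (hA : ∀ v, A v v)
    {δ N : ℝ} (hδ0 : 0 < δ) (hδ1 : δ < 1) (hN : 0 < N) (hV : (Fintype.card V : ℝ) = N)
    (hout : ∀ v, δ * N ≤ (univ.filter fun w => A v w).card) :
    ∃ C Ip Im : Finset V, ∃ π : Equiv.Perm V, Disjoint Ip Im ∧ Ip ⊆ C ∧ Im ⊆ C ∧
      Ip.card = ⌊δ * N / 4⌋₊ ∧ Im.card = ⌊δ * N / 4⌋₊ ∧ (∀ v, A v (π v)) ∧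
      (∀ s : V → ℝ, (∀ v ∉ C, s v = 0) → ∑ v ∈ C, s v = 0 →
        ∃ h : V → ℝ, ∀ v, h (π v) = h v + s v) ∧
      ∀ Z S : Finset V, Disjoint S Z → (S ∩ Ip).Nonempty → (Z.card : ℝ) < δ ^ 9 * N →
        (Z.card : ℝ) < δ / 4 * N → (∀ v ∈ S, ∀ w, A v w → w ∈ S ∨ w ∈ Z) →
        ∀ w ∈ Im, w ∉ Z → w ∈ S := by
  have : Nonempty V := Fintype.card_pos_iff.1 (by
    have : (0 : ℝ) < Fintype.card V := hV ▸ hN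
    exact_mod_cast this)
  have hl : 0 < 4 / δ - 3 := by
    rw [sub_pos, lt_div_iff₀ hδ0]
    linarith
  obtain ⟨Z, R, hR, hcl, hRZ, hrob⟩ := exists_robust_set A (4 / δ - 3) hl.le
  set q : ℝ := min (δ ^ 9) (δ / 4)
  set t : ℝ := (4 / δ - 3) * (q * N) with ht
  have hq0 : 0 ≤ q := le_min (by positivity) (by positivity)
  obtain ⟨K, hKR, hKne, hK1, hK2⟩ := exists_core A R hR (δ := δ) (N := N) (z := Z.card) (t := t)
    hδ0 hδ1 hN (Nat.cast_nonneg _) (by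
      intro v hv
      have h1 : (univ.filter fun w => A v w).card ≤ (R.filter fun w => A v w).card + Z.card := by
        refine le_trans (card_le_card ?_) (card_union_le _ _)
        intro w hw
        have hw' := (mem_filter.1 hw).2
        have := hcl v hv w hw'
        simp only [mem_union, mem_filter]
        tauto
      have h2 : ((univ.filter fun w => A v w).card : ℝ) ≤
        (R.filter fun w => A v w).card + Z.card := by exact_mod_cast h1
      linarith [hout v]) (hV ▸ hRZ) (by positivity) (by
      calc t ≤ (4 / δ - 3) * (δ ^ 9 * N) := by
            rw [ht]
            gcongr
            exact min_le_left _ _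
        _ = _ := by
            field_simp) (by
      calc t ≤ (4 / δ - 3) * (δ / 4 * N) := by
            rw [ht]
            gcongr
            exact min_le_right _ _
        _ = _ := by
            field_simp)
  obtain ⟨C, π, ⟨v, hvK, hvC⟩, hπ, hCK, hcob⟩ := exists_cycle A hA K hKne
  have hC1 : δ * N / 2 ≤ C.card := (hK1 v hvK).trans (by
    refine Nat.cast_le.2 (card_le_card fun w hw => ?_)
    exact hvC w (mem_filter.1 hw).1 (mem_filter.1 hw).2)
  have hk : (⌊δ * N / 4⌋₊ : ℝ) ≤ δ * N / 4 := Nat.floor_le (by positivity)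
  obtain ⟨Im, hIm, hImc⟩ := exists_subset_card_eq
    (s := C.filter fun w => t ≤ (R.filter fun u => A u w).card) (n := ⌊δ * N / 4⌋₊) (by
      have h1 := hk.trans (hK2 v hvK)
      refine (Nat.cast_le.1 h1).trans (card_le_card fun w hw => ?_)
      rw [mem_filter] at hw ⊢
      exact ⟨hvC w hw.1 hw.2.1, hw.2.2⟩)
  have hImC : Im ⊆ C := hIm.trans (filter_subset _ _)
  obtain ⟨Ip, hIp, hIpc⟩ := exists_subset_card_eq (s := C \ Im) (n := ⌊δ * N / 4⌋₊) (by
    rw [card_sdiff_of_subset hImC, hImc]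
    have h1 : ((⌊δ * N / 4⌋₊ + ⌊δ * N / 4⌋₊ : ℕ) : ℝ) ≤ C.card := by
      push_cast
      linarith
    have := Nat.cast_le.1 h1
    omega)
  refine ⟨C, Ip, Im, π, disjoint_sdiff_self_left.mono_left hIp, hIp.trans sdiff_subset, hImC,
    hIpc, hImc, hπ, hcob, fun Z' S hSZ hSI hZ1 hZ2 hS w hw hwZ => ?_⟩
  by_contra hwS
  have h1 := hrob Z' S hSZ (hSI.mono (inter_subset_inter_left
    (hIp.trans (sdiff_subset.trans (hCK.trans hKR))))) hS
  have h2 : (4 / δ - 3) * (Z'.card : ℝ) < t := by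
    refine mul_lt_mul_of_pos_left ?_ hl
    rw [min_mul_of_nonneg _ _ hN.le]
    exact lt_min hZ1 hZ2
  have h3 : (R.filter fun u => A u w).card ≤ (R \ S).card := by
    refine card_le_card fun u hu => ?_
    rw [mem_filter] at hu
    refine mem_sdiff.2 ⟨hu.1, fun huS => ?_⟩
    exact (hS u huS w hu.2).elim hwS hwZ
  have h4 := (mem_filter.1 (hIm hw)).2
  have h5 : ((R.filter fun u => A u w).card : ℝ) ≤ (R \ S).card := by exact_mod_cast h3
  linarith

/-- A zero-sum perturbation `s` of the row sums `1 / 2` supported on a cycle can be realised by a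
weighting with all nonzero weights at least `1 / 8`, if the cycle can be supplemented by links
between the positions where the perturbation accumulates. -/
theorem exists_weighting {V : Type*} [Fintype V] (A : V → V → Prop) (hA : ∀ v, A v v)
    (Ip Im : Finset V) (π : Equiv.Perm V) (hπ : ∀ v, A v (π v)) (s h : V → ℝ)
    (hh : ∀ v, h (π v) = h v + s v) (hpos : ∀ v ∈ Ip, 0 ≤ s v)
    (hp : ∀ v ∉ Ip, s v ≤ 0) (hm : ∀ v ∉ Im, 0 ≤ s v)
    (hs : ∀ v, |s v| < 1 / 8)
    (hlink : ∀ U W : Finset V, U ⊆ Ip → W ⊆ Im → U.card = W.card →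
      (U.card : ℝ) ≤ 8 * ∑ v ∈ Ip, s v →
      ∃ τ : Equiv.Perm V, (∀ v, τ v ∈ U ↔ v ∈ W) ∧ ∀ v ∉ W, A v (τ v)) :
    ∃ ω : V → V → ℝ, (∀ i j, ω i j ≠ 0 → A i j) ∧ (∀ i j, 0 ≤ ω i j) ∧
      (∀ i j, ω i j ≠ 0 → 1 / 8 ≤ ω i j) ∧ (∀ i, ∑ j, ω i j = 1 / 2 + s i) ∧
      ∀ j, ∑ i, ω i j = 1 / 2 := by
  obtain ⟨θ, hθ⟩ := exists_sum_floor_le Ip (fun v => 8 * h v) (fun v => 8 * h (π v))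
  set g : V → ℤ := fun v => ⌊8 * h (π v) + θ⌋ - ⌊8 * h v + θ⌋ with hg
  have hbd : ∀ v, -1 ≤ g v ∧ g v ≤ 1 := by
    intro v
    have h1 := abs_lt.1 (hs v)
    have h2 : (-1 : ℤ) ≤ g v := by
      have : ⌊8 * h v + θ⌋ ≤ ⌊8 * h (π v) + θ + 1⌋ := Int.floor_le_floor (by rw [hh]; linarith)
      rw [Int.floor_add_one] at this
      simp only [hg]
      omega
    have h3 : g v ≤ 1 := by
      have : ⌊8 * h (π v) + θ⌋ ≤ ⌊8 * h v + θ + 1⌋ := Int.floor_le_floor (by rw [hh]; linarith)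
      rw [Int.floor_add_one] at this
      simp only [hg]
      omega
    exact ⟨h2, h3⟩
  have hgp : ∀ v, 0 ≤ s v → 0 ≤ g v := by
    intro v hv
    have : ⌊8 * h v + θ⌋ ≤ ⌊8 * h (π v) + θ⌋ := Int.floor_le_floor (by rw [hh]; linarith)
    simp only [hg]
    omega
  have hgm : ∀ v, s v ≤ 0 → g v ≤ 0 := by
    intro v hv
    have : ⌊8 * h (π v) + θ⌋ ≤ ⌊8 * h v + θ⌋ := Int.floor_le_floor (by rw [hh]; linarith)
    simp only [hg]
    omega
  have hgsum : ∑ v, g v = 0 := by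
    rw [hg, sum_sub_distrib, Equiv.sum_comp π (fun v => ⌊8 * h v + θ⌋), sub_self]
  set U := univ.filter fun v => g v = 1 with hU
  set W := univ.filter fun v => g v = -1 with hW
  have hgUW : ∀ v, g v = (if v ∈ U then 1 else 0) - (if v ∈ W then 1 else 0) := by
    intro v
    have := hbd v
    simp only [hU, hW, mem_filter, mem_univ, true_and]
    split_ifs <;> omega
  have hUIp : U ⊆ Ip := by
    intro v hv
    by_contra hvI
    have := hgm v (hp v hvI)
    have := (mem_filter.1 hv).2
    omega
  have hWIm : W ⊆ Im := by
    intro v hv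
    by_contra hvI
    have := hgp v (hm v hvI)
    have := (mem_filter.1 hv).2
    omega
  have hcard : U.card = W.card := by
    have h1 : ∑ v, g v = (U.card : ℤ) - W.card := by
      rw [sum_congr rfl fun v _ => hgUW v, sum_sub_distrib]
      simp
    omega
  have hUle : (U.card : ℝ) ≤ 8 * ∑ v ∈ Ip, s v := by
    have h1 : (U.card : ℤ) ≤ ∑ v ∈ Ip, g v := by
      have h2 : (U.card : ℤ) = ∑ v ∈ U, g v := by
        rw [sum_congr rfl fun v hv => (mem_filter.1 hv).2]
        simp [hU]
      rw [h2]
      exact sum_le_sum_of_subset_of_nonneg hUIp fun v hv _ => hgp v (hpos v hv)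
    have h2 : ∑ v ∈ Ip, (8 * h (π v) - 8 * h v) = 8 * ∑ v ∈ Ip, s v := by
      rw [mul_sum]
      refine sum_congr rfl fun v _ => ?_
      rw [hh]
      ring
    rw [h2] at hθ
    exact le_trans (by exact_mod_cast h1) hθ
  obtain ⟨τ, hτ, hτA⟩ := hlink U W hUIp hWIm hcard hUle
  set φ : V → ℝ := fun v => 1 / 8 + Int.fract (8 * h v + θ) / 8 with hφ
  have hφ0 : ∀ v, 1 / 8 ≤ φ v := fun v => by
    have := Int.fract_nonneg (8 * h v + θ)
    simp only [hφ]
    linarith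
  have hφ1 : ∀ v, φ v < 1 / 4 := fun v => by
    have := Int.fract_lt_one (8 * h v + θ)
    simp only [hφ]
    linarith
  have hφπ : ∀ v, φ (π v) = φ v + s v - g v / 8 := by
    intro v
    simp only [hφ, hg, Int.fract]
    push_cast
    rw [hh]
    ring
  set r : V → ℝ := fun v => 1 / 2 - φ v - if v ∈ U then 0 else 1 / 8 with hr
  have hr0 : ∀ v, 1 / 8 ≤ r v := by
    intro v
    have := hφ1 v
    simp only [hr]
    split_ifs <;> linarith
  refine ⟨fun i j => (if j = π i then φ j else 0) + (if i ∉ W ∧ j = τ i then 1 / 8 else 0) +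
    (if i = j then r i else 0), ?_, ?_, ?_, ?_, ?_⟩
  · intro i j
    contrapose!
    intro hij
    have h1 : j ≠ π i := fun e => hij (e ▸ hπ i)
    have h2 : ¬ (i ∉ W ∧ j = τ i) := fun e => hij (e.2 ▸ hτA i e.1)
    have h3 : i ≠ j := fun e => hij (e ▸ hA i)
    simp [h1, h2, h3]
  · intro i j
    have := hφ0 j
    have := hr0 i
    dsimp only
    split_ifs <;> linarith
  · intro i j
    have := hφ0 j
    have := hr0 i
    dsimp only
    split_ifs <;> intro hne <;> first | linarith | exact absurd (by norm_num) hne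
  · intro i
    have h1 : ∑ j, (if i ∉ W ∧ j = τ i then (1 / 8 : ℝ) else 0) = if i ∈ W then 0 else 1 / 8 := by
      by_cases hi : i ∈ W <;> simp [hi]
    rw [sum_add_distrib, sum_add_distrib, h1]
    simp only [sum_ite_eq', sum_ite_eq, mem_univ, if_true, hφπ, hgUW i, hr]
    push_cast
    split_ifs <;> ring
  · intro j
    have h1 : ∑ i, (if i ∉ W ∧ j = τ i then (1 / 8 : ℝ) else 0) = if j ∈ U then 0 else 1 / 8 := by
      rw [← Equiv.sum_comp τ.symm]
      simp only [← hτ, Equiv.apply_symm_apply]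
      by_cases hj : j ∈ U
      · refine (sum_eq_zero fun x _ => ?_).trans (by simp [hj])
        rw [if_neg]
        rintro ⟨h, rfl⟩
        exact h hj
      · rw [sum_eq_single j] <;> simp +contextual [hj, eq_comm]
    have h2 : ∑ i, (if j = π i then φ j else 0) = φ j := by
      rw [← Equiv.sum_comp π.symm]
      simp
    rw [sum_add_distrib, sum_add_distrib, h1, h2]
    simp only [sum_ite_eq', mem_univ, if_true, hr]
    ring

end

theorem balanced_fractional_matching (c μ δ : ℝ)
    (hc0 : 0 < c) (hc1 : c < 1) (hμ0 : 0 < μ) (hμ1 : μ < 1) (hδ0 : 0 < δ) (hδ1 : δ < 1)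
    (hcμ : c + μ ≤ 1 / 8) :
    ∃ n₀ : ℕ, ∀ n : ℕ, n₀ ≤ n →
      ∀ A : Fin n → Fin n → Prop,
        (∀ i, A i i) →
        (∀ i : Fin n, δ * n ≤ (({j | A i j} : Set (Fin n)).ncard : ℝ)) →
        ∃ Ip Im : Finset (Fin n), Disjoint Ip Im ∧
          Ip.card = ⌊δ * n / 4⌋₊ ∧ Im.card = ⌊δ * n / 4⌋₊ ∧
          ∀ ωX ωY : Fin n → ℝ,
            (∀ i, ωY i = 1 / 2) →
            (∀ i ∉ Ip, 1 / 2 - c ≤ ωX i ∧ ωX i ≤ 1 / 2) →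
            (∀ i ∉ Im, 1 / 2 ≤ ωX i ∧ ωX i ≤ 1 / 2 + c) →
            (∑ i ∈ Ip, (ωX i - ωY i)) = (∑ j ∈ Im, (ωY j - ωX j)) →
            (∑ i ∈ Ip, (ωX i - ωY i)) < δ ^ 9 * n / 8 →
            ∃ ω : Fin n → Fin n → ℝ,
              (∀ i j, ω i j ≠ 0 → A i j) ∧
              (∀ i j, 0 ≤ ω i j) ∧
              (∀ i j, ω i j ≤ 1) ∧
              (∀ i j, ω i j ≠ 0 → 1 / 8 ≤ ω i j) ∧
              (∀ i, 1 / 2 - c ≤ ∑ j, ω i j ∧ ∑ j, ω i j ≤ ωX i) ∧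
              (∀ j, 1 / 2 - c ≤ ∑ i, ω i j ∧ ∑ i, ω i j ≤ ωY j) ∧
              (∑ i, ωX i) - μ * n ≤ ∑ i, ∑ j, ω i j := by
  classical
  refine ⟨1, fun n hn A hA hdeg => ?_⟩
  have hN : (0 : ℝ) < n := by exact_mod_cast hn
  obtain ⟨C, Ip, Im, π, hdisj, hIpC, hImC, hIpc, hImc, hπ, hcob, hsep⟩ :=
    exists_linked_sets A hA hδ0 hδ1 hN (by simp) (fun v => by
      refine (hdeg v).trans_eq ?_
      rw [Set.ncard_eq_toFinset_card']
      congr 2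
      ext w
      simp)
  refine ⟨Ip, Im, hdisj, hIpc, hImc, fun ωX ωY hY hp hm hsum hlt => ?_⟩
  simp only [hY] at hsum hlt
  have hc : c < 1 / 8 := by linarith
  have hrange : ∀ i, 1 / 2 - c ≤ ωX i ∧ ωX i ≤ 1 / 2 + c := by
    intro i
    by_cases hi : i ∈ Ip
    · have := hm i (Finset.disjoint_left.1 hdisj hi)
      constructor <;> linarith
    · have := hp i hi
      constructor <;> linarith
  have hzero : ∀ i, i ∉ Ip ∪ Im → ωX i - 1 / 2 = 0 := by
    intro i hi
    rw [Finset.mem_union, not_or] at hi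
    linarith [(hp i hi.1).2, (hm i hi.2).1]
  obtain ⟨h, hh⟩ := hcob (fun i => ωX i - 1 / 2)
    (fun i hi => hzero i fun hi' => hi (Finset.union_subset hIpC hImC hi')) (by
      rw [← Finset.sum_subset (Finset.union_subset hIpC hImC) (fun i _ hi => hzero i hi),
        Finset.sum_union hdisj, hsum, ← Finset.sum_add_distrib]
      simp)
  obtain ⟨ω, h1, h2, h3, h4, h5⟩ := exists_weighting A hA Ip Im π hπ (fun i => ωX i - 1 / 2) h hh
    (fun i hi => by linarith [(hm i (Finset.disjoint_left.1 hdisj hi)).1])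
    (fun i hi => by linarith [(hp i hi).2]) (fun i hi => by linarith [(hm i hi).1])
    (fun i => by
      have := hrange i
      rw [abs_lt]
      constructor <;> linarith)
    (fun U W hU hW hUW hle => by
      refine exists_linking A hA U W hUW fun Z S hSZ hSU hZ hS => ?_
      have hZ' : (Z.card : ℝ) < U.card := by exact_mod_cast hZ
      have hUk : (U.card : ℝ) ≤ δ * n / 4 :=
        le_trans (by exact_mod_cast hIpc ▸ Finset.card_le_card hU) (Nat.floor_le (by positivity))
      obtain ⟨w, hw, hwZ⟩ := Finset.exists_mem_notMem_of_card_lt_card (hUW ▸ hZ)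
      exact ⟨w, hw, hsep Z S hSZ (hSU.mono (Finset.inter_subset_inter_left hU)) (by linarith)
        (by linarith) hS w (hW hw) hwZ⟩)
  have h4' : ∀ i, ∑ j, ω i j = ωX i := fun i => by rw [h4]; ring
  refine ⟨ω, h1, h2, fun i j => ?_, h3, fun i => ?_, fun j => ?_, ?_⟩
  · have := Finset.single_le_sum (f := fun j => ω i j) (fun j _ => h2 i j) (Finset.mem_univ j)
    have := (hrange i).2
    have := h4' i
    linarith
  · rw [h4']
    exact ⟨(hrange i).1, le_rfl⟩
  · rw [h5, hY]
    constructor <;> linarith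
  · simp only [h4']
    have := mul_pos hμ0 hN
    linarith
end

section
/- For every δ₀ with 0 < δ₀ ≤ 1/8 there exists n₀ = n₀(δ₀) such that the following holds for all n ≥ n₀: if G is an edge-coloured multigraph on n vertices with δ_mon(G) ≥ δ₀n and |φ(G)| ≤ δ₀n/16, then there exists a rainbow cycle system 𝒞 in G with φ(𝒞) = φ(G) and |𝒞| ≤ 2^18·δ₀^(−5). -/
/-- An edge-coloured multigraph on `Fin n` is modelled as a family `G : γ → SimpleGraph (Fin n)`
of colour classes: `G c` is the simple graph formed by the edges of colour `c` (parallel edges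
get distinct colours).  `(s, cs)` is a rainbow cycle with vertex set `s` and colour set `cs`:
either a single edge (a degenerate cycle), or a cyclic sequence of at least two distinct
vertices in which consecutive vertices are joined by edges of pairwise distinct colours. -/
def IsRainbowCycle {n : ℕ} {γ : Type*} [DecidableEq γ] (G : γ → SimpleGraph (Fin n))
    (s : Finset (Fin n)) (cs : Finset γ) : Prop :=
  (∃ (u v : Fin n) (c : γ), (G c).Adj u v ∧ s = {u, v} ∧ cs = {c}) ∨
  (∃ (m : ℕ) (f : ℕ → Fin n) (col : ℕ → γ),
    2 ≤ m ∧ m = s.card ∧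
    (∀ i, f (i + m) = f i) ∧ Set.InjOn f (Set.Iio m) ∧ (Finset.range m).image f = s ∧
    (∀ i, col (i + m) = col i) ∧ Set.InjOn col (Set.Iio m) ∧
    (Finset.range m).image col = cs ∧
    ∀ i, (G (col i)).Adj (f i) (f (i + 1)))

/-- `(s, cs)` is a rainbow path with vertex set `s` and colour set `cs` in the edge-coloured
multigraph given by the family `G` of colour classes: a sequence of `m ≥ 2` distinct vertices
in which consecutive vertices are joined by edges of pairwise distinct colours. -/
def IsRainbowPath {n : ℕ} {γ : Type*} [DecidableEq γ] (G : γ → SimpleGraph (Fin n))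
    (s : Finset (Fin n)) (cs : Finset γ) : Prop :=
  ∃ (m : ℕ) (f : ℕ → Fin n) (col : ℕ → γ),
    2 ≤ m ∧ m = s.card ∧
    Set.InjOn f (Set.Iio m) ∧ (Finset.range m).image f = s ∧
    Set.InjOn col (Set.Iio (m - 1)) ∧ (Finset.range (m - 1)).image col = cs ∧
    ∀ i < m - 1, (G (col i)).Adj (f i) (f (i + 1))

section RainbowCycleSystem

open scoped Classical

variable {n : ℕ} {γ : Type*}

/-- The number of colours of `S` carried by the pair `x`, `y`. -/
noncomputable def colourMult (G : γ → SimpleGraph (Fin n)) (S : Finset γ) (x y : Fin n) : ℕ :=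
  (S.filter fun c => (G c).Adj x y).card

/-- The vertices of `W` joined to `x` in colour `c` along a pair carrying at least `θ` colours
of `S`. -/
noncomputable def richNbhd (G : γ → SimpleGraph (Fin n)) (θ : ℕ) (S : Finset γ)
    (W : Finset (Fin n)) (c : γ) (x : Fin n) : Finset (Fin n) :=
  W.filter fun y => (G c).Adj x y ∧ θ ≤ colourMult G S x y

/-- Every vertex of `W` has, in some colour of `S`, at least `d` rich neighbours inside `W`. -/
def IsRichSet (G : γ → SimpleGraph (Fin n)) (θ : ℕ) (d : ℝ) (S : Finset γ)
    (W : Finset (Fin n)) : Prop :=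
  ∀ x ∈ W, ∃ c ∈ S, d ≤ ((richNbhd G θ S W c x).card : ℝ)

/-- The largest rich subset of `U`. -/
noncomputable def richCore (G : γ → SimpleGraph (Fin n)) (θ : ℕ) (d : ℝ) (S : Finset γ)
    (U : Finset (Fin n)) : Finset (Fin n) :=
  U.filter fun x => ∃ W ⊆ U, IsRichSet G θ d S W ∧ x ∈ W

/-- The graph of pairs carrying at least `θ` colours of `S` inside the largest rich subset
of `U`. -/
def richGraph (G : γ → SimpleGraph (Fin n)) (θ : ℕ) (d : ℝ) (S : Finset γ)
    (U : Finset (Fin n)) : SimpleGraph (Fin n) where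
  Adj x y := x ≠ y ∧ x ∈ richCore G θ d S U ∧ y ∈ richCore G θ d S U ∧ θ ≤ colourMult G S x y
  symm := ⟨fun x y h => ⟨h.1.symm, h.2.2.1, h.2.1, by
    have := h.2.2.2
    simpa only [colourMult, SimpleGraph.adj_comm] using this⟩⟩
  loopless := ⟨fun _ h => h.1 rfl⟩

/-- Two vertices of the largest rich subset of `U` that lie in the same component of the rich
graph. -/
def Linked (G : γ → SimpleGraph (Fin n)) (θ : ℕ) (d : ℝ) (S : Finset γ)
    (U : Finset (Fin n)) (x y : Fin n) : Prop :=
  x ∈ richCore G θ d S U ∧ y ∈ richCore G θ d S U ∧ (richGraph G θ d S U).Reachable x y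

/-- The set of linked pairs. -/
noncomputable def linkedPairs (G : γ → SimpleGraph (Fin n)) (θ : ℕ) (d : ℝ) (S : Finset γ)
    (U : Finset (Fin n)) : Finset (Fin n × Fin n) :=
  Finset.univ.filter fun p => Linked G θ d S U p.1 p.2

variable {G : γ → SimpleGraph (Fin n)} {θ : ℕ} {d : ℝ} {S S' : Finset γ} {U U' : Finset (Fin n)}

theorem colourMult_mono (h : S' ⊆ S) (x y : Fin n) : colourMult G S' x y ≤ colourMult G S x y :=
  Finset.card_le_card (Finset.filter_subset_filter _ h)

theorem richNbhd_mono {W W' : Finset (Fin n)} (h : S' ⊆ S) (hW : W' ⊆ W) (c : γ) (x : Fin n) :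
    richNbhd G θ S' W' c x ⊆ richNbhd G θ S W c x := by
  intro y hy
  simp only [richNbhd, Finset.mem_filter] at hy ⊢
  exact ⟨hW hy.1, hy.2.1, hy.2.2.trans (colourMult_mono h x y)⟩

theorem IsRichSet.subset_richCore {W : Finset (Fin n)} (hW : IsRichSet G θ d S W) (hU : W ⊆ U) :
    W ⊆ richCore G θ d S U := fun _ hx =>
  Finset.mem_filter.2 ⟨hU hx, W, hU, hW, hx⟩

theorem richCore_subset : richCore G θ d S U ⊆ U := Finset.filter_subset _ _

theorem isRichSet_richCore : IsRichSet G θ d S (richCore G θ d S U) := by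
  intro x hx
  obtain ⟨-, W, hWU, hW, hxW⟩ := Finset.mem_filter.1 hx
  obtain ⟨c, hc, hd⟩ := hW x hxW
  refine ⟨c, hc, hd.trans ?_⟩
  exact_mod_cast Finset.card_le_card (richNbhd_mono subset_rfl (hW.subset_richCore hWU) c x)

theorem richCore_mono (hS : S' ⊆ S) (hU : U' ⊆ U) :
    richCore G θ d S' U' ⊆ richCore G θ d S U := by
  refine IsRichSet.subset_richCore (fun x hx => ?_) (richCore_subset.trans hU)
  obtain ⟨c, hc, hd⟩ := isRichSet_richCore x hx
  refine ⟨c, hS hc, hd.trans ?_⟩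
  exact_mod_cast Finset.card_le_card (richNbhd_mono hS subset_rfl c x)

theorem Linked.mono (hS : S' ⊆ S) (hU : U' ⊆ U) {x y : Fin n} (h : Linked G θ d S' U' x y) :
    Linked G θ d S U x y := by
  refine ⟨richCore_mono hS hU h.1, richCore_mono hS hU h.2.1, h.2.2.mono ?_⟩
  intro a b hab
  exact ⟨hab.1, richCore_mono hS hU hab.2.1, richCore_mono hS hU hab.2.2.1,
    hab.2.2.2.trans (colourMult_mono hS a b)⟩

theorem Linked.symm {x y : Fin n} (h : Linked G θ d S U x y) : Linked G θ d S U y x :=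
  ⟨h.2.1, h.1, h.2.2.symm⟩

theorem Linked.trans {x y z : Fin n} (h : Linked G θ d S U x y) (h' : Linked G θ d S U y z) :
    Linked G θ d S U x z :=
  ⟨h.1, h'.2.1, h.2.2.trans h'.2.2⟩

theorem linked_of_mem_richNbhd {c : γ} {x y : Fin n} (hx : x ∈ richCore G θ d S U)
    (hy : y ∈ richNbhd G θ S (richCore G θ d S U) c x) : Linked G θ d S U x y := by
  simp only [richNbhd, Finset.mem_filter] at hy
  exact ⟨hx, hy.1, SimpleGraph.Adj.reachable ⟨hy.2.1.ne, hx, hy.1, hy.2.2⟩⟩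

theorem linkedPairs_mono (hS : S' ⊆ S) (hU : U' ⊆ U) :
    linkedPairs G θ d S' U' ⊆ linkedPairs G θ d S U := by
  intro p hp
  simp only [linkedPairs, Finset.mem_filter, Finset.mem_univ, true_and] at hp ⊢
  exact hp.mono hS hU

theorem card_linkedPairs_add_le (hS : S' ⊆ S) (hU : U' ⊆ U) (hd : 0 ≤ d) {Y : Finset (Fin n)}
    (hY : d ≤ (Y.card : ℝ)) (X : Fin n → Finset (Fin n))
    (hX : ∀ y ∈ Y, d ≤ ((X y).card : ℝ))
    (hlink : ∀ y ∈ Y, ∀ x ∈ X y, Linked G θ d S U y x)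
    (hlost : ∀ y ∈ Y, (((X y).filter (Linked G θ d S' U' y)).card : ℝ) < d / 2) :
    ((linkedPairs G θ d S' U').card : ℝ) + d ^ 2 / 2 ≤ (linkedPairs G θ d S U).card := by
  let Z : Finset (Σ _ : Fin n, Fin n) :=
    Y.sigma fun y => (X y).filter fun x => ¬ Linked G θ d S' U' y x
  let Z' : Finset (Fin n × Fin n) := Z.image fun p => (p.1, p.2)
  have hZ' : Z'.card = Z.card := by
    refine Finset.card_image_of_injective _ ?_
    rintro ⟨a, b⟩ ⟨a', b'⟩ h
    simp only [Prod.mk.injEq] at h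
    rw [h.1, h.2]
  have hZcard : d * (d / 2) ≤ (Z.card : ℝ) := by
    rw [Finset.card_sigma]
    push_cast
    calc d * (d / 2) ≤ (Y.card : ℝ) * (d / 2) := by gcongr
      _ = ∑ y ∈ Y, d / 2 := by simp
      _ ≤ _ := Finset.sum_le_sum fun y hy => by
        have h1 := hX y hy
        have h2 := hlost y hy
        have h3 := Finset.card_filter_add_card_filter_not (s := X y) (Linked G θ d S' U' y)
        have h4 : (((X y).filter (Linked G θ d S' U' y)).card : ℝ)
          + ((X y).filter fun x => ¬ Linked G θ d S' U' y x).card = (X y).card := by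
          exact_mod_cast h3
        linarith
  have hdisj : Disjoint (linkedPairs G θ d S' U') Z' := by
    rw [Finset.disjoint_left]
    intro p hp hpZ
    simp only [Z', Z, Finset.mem_image, Finset.mem_sigma, Finset.mem_filter] at hpZ
    obtain ⟨q, hq, rfl⟩ := hpZ
    simp only [linkedPairs, Finset.mem_filter, Finset.mem_univ, true_and] at hp
    exact hq.2.2 hp
  have hsub : linkedPairs G θ d S' U' ∪ Z' ⊆ linkedPairs G θ d S U := by
    refine Finset.union_subset (linkedPairs_mono hS hU) ?_
    intro p hpZ
    simp only [Z', Z, Finset.mem_image, Finset.mem_sigma, Finset.mem_filter] at hpZ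
    obtain ⟨q, hq, rfl⟩ := hpZ
    simp only [linkedPairs, Finset.mem_filter, Finset.mem_univ, true_and]
    exact hlink _ hq.1 _ hq.2.1
  have hcard := Finset.card_le_card hsub
  rw [Finset.card_union_of_disjoint hdisj, hZ'] at hcard
  have : ((linkedPairs G θ d S' U').card : ℝ) + Z.card ≤ (linkedPairs G θ d S U).card := by
    exact_mod_cast hcard
  nlinarith

/-- The vertices `f 0, …, f L` of `U` form a path whose edges have the pairwise distinct colours
`col 0, …, col (L - 1)` of `S`. -/
structure IsRainbowWalkIn (G : γ → SimpleGraph (Fin n)) (U : Finset (Fin n)) (S : Finset γ)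
    (L : ℕ) (f : ℕ → Fin n) (col : ℕ → γ) : Prop where
  injOn_vertex : Set.InjOn f (Set.Iic L)
  injOn_colour : Set.InjOn col (Set.Iio L)
  vertex_mem : ∀ i ≤ L, f i ∈ U
  colour_mem : ∀ i < L, col i ∈ S
  adj : ∀ i < L, (G (col i)).Adj (f i) (f (i + 1))

theorem card_nbrs_of_shortest_walk {V : Type*} {H : SimpleGraph V} {a b : V} (p : H.Walk a b)
    (hp : p.length = H.dist a b) (v : V) :
    ((Finset.range (p.length + 1)).filter fun i => H.Adj (p.getVert i) v).card ≤ 3 := by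
  set T := (Finset.range (p.length + 1)).filter fun i => H.Adj (p.getVert i) v with hT
  have key : ∀ i ∈ T, ∀ j ∈ T, j ≤ i + 2 := by
    intro i hi j hj
    simp only [hT, Finset.mem_filter, Finset.mem_range] at hi hj
    let q : H.Walk a b :=
      (p.take i).append ((SimpleGraph.Walk.cons hi.2
        (SimpleGraph.Walk.cons hj.2.symm (p.drop j))))
    have hq := SimpleGraph.dist_le q
    simp only [q, SimpleGraph.Walk.length_append, SimpleGraph.Walk.length_cons,
      SimpleGraph.Walk.take_length, SimpleGraph.Walk.drop_length] at hq
    omega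
  rcases T.eq_empty_or_nonempty with h | h
  · simp [h]
  · have hsub : T ⊆ Finset.Icc (T.min' h) (T.min' h + 2) := by
      intro j hj
      exact Finset.mem_Icc.2 ⟨T.min'_le j hj, key _ (T.min'_mem h) j hj⟩
    calc T.card ≤ _ := Finset.card_le_card hsub
      _ = 3 := by simp; omega

theorem length_le_of_shortest_walk (hdiam : 3 * (n : ℝ) < (θ + 1) * d) {a b : Fin n}
    (ha : a ∈ richCore G θ d S U)
    (p : (richGraph G θ d S U).Walk a b) (hp : p.length = (richGraph G θ d S U).dist a b) :
    p.length ≤ θ := by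
  by_contra! hlt
  have hmem : ∀ i, p.getVert i ∈ richCore G θ d S U := by
    intro i
    induction i with
    | zero => simpa using ha
    | succ i ih =>
      by_cases h : i < p.length
      · exact (p.adj_getVert_succ h).2.2.1
      · rw [p.getVert_of_length_le (by omega)]
        rwa [p.getVert_of_length_le (by omega)] at ih
  have hdeg : ∀ i, d ≤ ((Finset.univ.filter fun v =>
      (richGraph G θ d S U).Adj (p.getVert i) v).card : ℝ) := by
    intro i
    obtain ⟨c, -, hd⟩ := isRichSet_richCore _ (hmem i)
    refine hd.trans ?_
    norm_cast
    refine Finset.card_le_card fun y hy => ?_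
    simp only [richNbhd, Finset.mem_filter] at hy
    simp only [Finset.mem_filter, Finset.mem_univ, true_and]
    exact ⟨hy.2.1.ne, hmem i, hy.1, hy.2.2⟩
  have hcount := Finset.sum_card_bipartiteAbove_eq_sum_card_bipartiteBelow
    (s := Finset.range (p.length + 1)) (t := (Finset.univ : Finset (Fin n)))
    (fun i v => (richGraph G θ d S U).Adj (p.getVert i) v)
  have h1 : ((p.length + 1 : ℕ) : ℝ) * d ≤
      ((∑ i ∈ Finset.range (p.length + 1),
        (Finset.univ.filter fun v => (richGraph G θ d S U).Adj (p.getVert i) v).card : ℕ) : ℝ) := by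
    push_cast
    calc ((p.length : ℝ) + 1) * d = ∑ i ∈ Finset.range (p.length + 1), d := by simp
      _ ≤ _ := Finset.sum_le_sum fun i _ => hdeg i
  have h2 : (∑ v : Fin n, ((Finset.range (p.length + 1)).filter
      fun i => (richGraph G θ d S U).Adj (p.getVert i) v).card) ≤ n * 3 := by
    calc _ ≤ ∑ v : Fin n, 3 := Finset.sum_le_sum fun v _ => card_nbrs_of_shortest_walk p hp v
      _ = n * 3 := by simp
  have h3 : ((p.length + 1 : ℕ) : ℝ) * d ≤ (n : ℝ) * 3 := by
    refine h1.trans ?_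
    have : (∑ i ∈ Finset.range (p.length + 1),
        (Finset.univ.filter fun v => (richGraph G θ d S U).Adj (p.getVert i) v).card) ≤ n * 3 := by
      simp only [Finset.bipartiteAbove, Finset.bipartiteBelow] at hcount
      exact hcount.trans_le h2
    exact_mod_cast this
  have hd0 : 0 < d := by
    by_contra! hd
    have : (0 : ℝ) ≤ 3 * n := by positivity
    nlinarith [(Nat.cast_nonneg θ : (0 : ℝ) ≤ θ)]
  have h4 : ((θ : ℝ) + 1) * d ≤ ((p.length + 1 : ℕ) : ℝ) * d := by
    have : (θ : ℝ) ≤ p.length := by exact_mod_cast hlt.le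
    push_cast
    gcongr
  linarith

theorem Linked.exists_rainbow_walk (hdiam : 3 * (n : ℝ) < (θ + 1) * d) {a b : Fin n}
    (h : Linked G θ d S U a b) (hab : a ≠ b) (hS : S.Nonempty) :
    ∃ L f col, 0 < L ∧ IsRainbowWalkIn G U S L f col ∧ f 0 = a ∧ f L = b := by
  obtain ⟨p, hpath, hp⟩ := h.2.2.exists_path_of_dist
  have hL := length_le_of_shortest_walk hdiam h.1 p hp
  let t : Fin p.length → Finset γ := fun i =>
    S.filter fun c => (G c).Adj (p.getVert i) (p.getVert (i + 1))
  have ht : ∀ i, θ ≤ (t i).card := fun i => (p.adj_getVert_succ i.2).2.2.2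
  have hall : ∀ s : Finset (Fin p.length), s.card ≤ (s.biUnion t).card := by
    intro s
    rcases s.eq_empty_or_nonempty with rfl | ⟨i, hi⟩
    · simp
    · calc s.card ≤ p.length := by simpa using Finset.card_le_univ s
        _ ≤ (t i).card := hL.trans (ht i)
        _ ≤ _ := Finset.card_le_card (Finset.subset_biUnion_of_mem t hi)
  obtain ⟨g, hg, hgt⟩ := (Finset.all_card_le_biUnion_card_iff_exists_injective t).1 hall
  obtain ⟨c₀, -⟩ := hS
  have hpos : 0 < p.length := by
    rw [Nat.pos_iff_ne_zero]
    exact fun h0 => hab (SimpleGraph.Walk.eq_of_length_eq_zero h0)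
  refine ⟨p.length, p.getVert, fun i => if hi : i < p.length then g ⟨i, hi⟩ else c₀, hpos,
    ⟨?_, ?_, ?_, ?_, ?_⟩, by simp, by simp⟩
  · exact hpath.getVert_injOn
  · intro i hi j hj hij
    simp only [Set.mem_Iio] at hi hj
    simp only [hi, hj, dif_pos] at hij
    simpa using hg hij
  · intro i hi
    rcases Nat.eq_or_lt_of_le hi with rfl | hi
    · simpa using richCore_subset h.2.1
    · exact richCore_subset (p.adj_getVert_succ hi).2.1
  · intro i hi
    simp only [hi, dif_pos]
    exact (Finset.mem_filter.1 (hgt ⟨i, hi⟩)).1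
  · intro i hi
    simp only [hi, dif_pos]
    exact (Finset.mem_filter.1 (hgt ⟨i, hi⟩)).2

theorem IsRainbowWalkIn.card_vertices {L : ℕ} {f : ℕ → Fin n} {col : ℕ → γ}
    (h : IsRainbowWalkIn G U S L f col) : ((Finset.range (L + 1)).image f).card = L + 1 := by
  rw [Finset.card_image_of_injOn, Finset.card_range]
  exact h.injOn_vertex.mono fun i hi => by simpa [Nat.lt_succ_iff] using hi

/-- Every colour class is non-empty and has minimum degree at least `D` on its support. -/
def MinMonDegree (G : γ → SimpleGraph (Fin n)) (D : ℝ) : Prop :=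
  ∀ c, (∃ x y, (G c).Adj x y) ∧
    ∀ x y, (G c).Adj x y → D ≤ ((Finset.univ.filter fun z => (G c).Adj x z).card : ℝ)

theorem card_le_card_inter_add_compl (X U : Finset (Fin n)) :
    (X.card : ℝ) ≤ ((X ∩ U).card : ℝ) + (Uᶜ.card : ℝ) := by
  have h1 := Finset.card_inter_add_card_sdiff X U
  have h2 : (X \ U).card ≤ Uᶜ.card := Finset.card_le_card fun v hv => by
    simpa using (Finset.mem_sdiff.1 hv).2
  exact_mod_cast (by omega : X.card ≤ (X ∩ U).card + Uᶜ.card)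

theorem MinMonDegree.exists_adj_mem {D : ℝ} (hG : MinMonDegree G D) (hU : (Uᶜ.card : ℝ) < D)
    (c : γ) : ∃ x ∈ U, ∃ y ∈ U, (G c).Adj x y := by
  have key : ∀ x y, (G c).Adj x y → ∃ z ∈ U, (G c).Adj x z := by
    intro x y hxy
    have h1 := (hG c).2 x y hxy
    have h2 := card_le_card_inter_add_compl (Finset.univ.filter fun z => (G c).Adj x z) U
    have h3 : (0 : ℝ) < (((Finset.univ.filter fun z => (G c).Adj x z) ∩ U).card : ℝ) := by
      linarith
    obtain ⟨z, hz⟩ := Finset.card_pos.1 (by exact_mod_cast h3)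
    simp only [Finset.mem_inter, Finset.mem_filter, Finset.mem_univ, true_and] at hz
    exact ⟨z, hz.2, hz.1⟩
  obtain ⟨x, y, hxy⟩ := (hG c).1
  obtain ⟨z, hzU, hz⟩ := key x y hxy
  obtain ⟨w, hwU, hw⟩ := key z x hz.symm
  exact ⟨z, hzU, w, hwU, hw⟩

/-- If `S` is large, then some colour of `S` is mostly carried, at all but few vertices, by pairs
with at least `θ` colours of `S`. -/
theorem exists_few_poor {D : ℝ} (hD : 0 < D)
    (hS : 32 * θ * (n : ℝ) ^ 2 < S.card * D ^ 2) :
    ∃ c ∈ S, ((Finset.univ.filter fun x => D / 4 ≤ ((Finset.univ.filter fun y =>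
      (G c).Adj x y ∧ colourMult G S x y < θ).card : ℝ)).card : ℝ) ≤ D / 8 := by
  by_contra! hcon
  have hrow : ∀ x : Fin n, ((S.filter fun c => D / 4 ≤ ((Finset.univ.filter fun y =>
      (G c).Adj x y ∧ colourMult G S x y < θ).card : ℝ)).card : ℝ) * (D / 4) ≤ θ * n := by
    intro x
    have hcount := Finset.sum_card_bipartiteAbove_eq_sum_card_bipartiteBelow
      (s := S) (t := (Finset.univ : Finset (Fin n)))
      (fun c y => (G c).Adj x y ∧ colourMult G S x y < θ)
    simp only [Finset.bipartiteAbove, Finset.bipartiteBelow] at hcount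
    have h1 : (∑ y : Fin n, (S.filter fun c => (G c).Adj x y ∧ colourMult G S x y < θ).card)
        ≤ n * θ := by
      calc _ ≤ ∑ _y : Fin n, θ := Finset.sum_le_sum fun y _ => by
            by_cases h : colourMult G S x y < θ
            · exact (Finset.card_le_card fun c hc => Finset.mem_filter.2
                ⟨(Finset.mem_filter.1 hc).1, (Finset.mem_filter.1 hc).2.1⟩).trans h.le
            · simp [h]
        _ = n * θ := by simp
    rw [← hcount] at h1
    have h2 : ((∑ c ∈ S, (Finset.univ.filter fun y => (G c).Adj x y ∧
        colourMult G S x y < θ).card : ℕ) : ℝ) ≤ n * θ := by exact_mod_cast h1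
    push_cast at h2
    calc _ = ∑ c ∈ S.filter fun c => D / 4 ≤ ((Finset.univ.filter fun y =>
          (G c).Adj x y ∧ colourMult G S x y < θ).card : ℝ), D / 4 := by simp
      _ ≤ ∑ c ∈ S.filter fun c => D / 4 ≤ ((Finset.univ.filter fun y =>
          (G c).Adj x y ∧ colourMult G S x y < θ).card : ℝ), ((Finset.univ.filter fun y =>
          (G c).Adj x y ∧ colourMult G S x y < θ).card : ℝ) :=
        Finset.sum_le_sum fun c hc => (Finset.mem_filter.1 hc).2
      _ ≤ ∑ c ∈ S, ((Finset.univ.filter fun y =>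
          (G c).Adj x y ∧ colourMult G S x y < θ).card : ℝ) :=
        Finset.sum_le_sum_of_subset_of_nonneg (Finset.filter_subset _ _)
          fun _ _ _ => by positivity
      _ ≤ θ * n := by linarith
  have hcount := Finset.sum_card_bipartiteAbove_eq_sum_card_bipartiteBelow
    (s := S) (t := (Finset.univ : Finset (Fin n)))
    (fun c x => D / 4 ≤ ((Finset.univ.filter fun y =>
      (G c).Adj x y ∧ colourMult G S x y < θ).card : ℝ))
  simp only [Finset.bipartiteAbove, Finset.bipartiteBelow] at hcount
  have hcount' := congrArg (Nat.cast : ℕ → ℝ) hcount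
  push_cast at hcount'
  have h1 := Finset.sum_le_sum fun c hc => (hcon c hc).le
  have h2 := Finset.sum_le_sum fun x (_ : x ∈ (Finset.univ : Finset (Fin n))) => hrow x
  rw [← Finset.sum_mul, ← hcount'] at h2
  simp only [Finset.sum_const, nsmul_eq_mul, Finset.card_univ, Fintype.card_fin] at h1 h2
  nlinarith

theorem MinMonDegree.exists_rich_colour {D : ℝ} (hG : MinMonDegree G D) (hD : 0 < D)
    (hU : (Uᶜ.card : ℝ) ≤ D / 8) (hS : 32 * θ * (n : ℝ) ^ 2 < S.card * D ^ 2) :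
    ∃ c ∈ S, ∃ W ⊆ richCore G θ (D / 2) S U, D / 2 ≤ (W.card : ℝ) ∧
      ∀ x ∈ W, D / 2 ≤ ((richNbhd G θ S (richCore G θ (D / 2) S U) c x).card : ℝ) := by
  obtain ⟨c, hc, hpoor⟩ := exists_few_poor (G := G) hD hS
  set B := Finset.univ.filter fun x => D / 4 ≤ ((Finset.univ.filter fun y =>
      (G c).Adj x y ∧ colourMult G S x y < θ).card : ℝ) with hB
  let W := U.filter fun x => (∃ y, (G c).Adj x y) ∧ x ∉ B
  have hsplit : ∀ X : Finset (Fin n), (∀ x ∈ X, ∃ y, (G c).Adj x y) →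
      (X.card : ℝ) ≤ ((X ∩ W).card : ℝ) + D / 4 := by
    intro X hX
    have h1 := card_le_card_inter_add_compl X U
    have h2 := card_le_card_inter_add_compl (X ∩ U) Bᶜ
    rw [compl_compl] at h2
    have h3 : (X ∩ U) ∩ Bᶜ ⊆ X ∩ W := by
      intro x hx
      simp only [Finset.mem_inter, Finset.mem_compl] at hx
      exact Finset.mem_inter.2 ⟨hx.1.1, Finset.mem_filter.2 ⟨hx.1.2, hX x hx.1.1, hx.2⟩⟩
    have h4 : ((((X ∩ U) ∩ Bᶜ).card : ℕ) : ℝ) ≤ (X ∩ W).card := by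
      exact_mod_cast Finset.card_le_card h3
    linarith
  have hnbr : ∀ x, (∃ y, (G c).Adj x y) →
      D * (3 / 4) ≤ (((Finset.univ.filter fun z => (G c).Adj x z) ∩ W).card : ℝ) := by
    rintro x ⟨y, hy⟩
    have h1 := (hG c).2 x y hy
    have h2 := hsplit (Finset.univ.filter fun z => (G c).Adj x z)
      fun z hz => ⟨x, (Finset.mem_filter.1 hz).2.symm⟩
    linarith
  have hrich : ∀ x ∈ W, D / 2 ≤ ((richNbhd G θ S W c x).card : ℝ) := by
    intro x hx
    obtain ⟨-, hxc, hxB⟩ := Finset.mem_filter.1 hx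
    simp only [hB, Finset.mem_filter, Finset.mem_univ, true_and, not_le] at hxB
    have h1 := hnbr x hxc
    have h2 : (Finset.univ.filter fun z => (G c).Adj x z) ∩ W ⊆ richNbhd G θ S W c x ∪
        Finset.univ.filter fun y => (G c).Adj x y ∧ colourMult G S x y < θ := by
      intro z hz
      simp only [richNbhd, Finset.mem_inter, Finset.mem_union, Finset.mem_filter,
        Finset.mem_univ, true_and] at hz ⊢
      rcases lt_or_ge (colourMult G S x z) θ with h | h <;> tauto
    have h3 := (Finset.card_le_card h2).trans (Finset.card_union_le _ _)
    have h4 : (((Finset.univ.filter fun z => (G c).Adj x z) ∩ W).card : ℝ) ≤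
        (richNbhd G θ S W c x).card + ((Finset.univ.filter fun y =>
          (G c).Adj x y ∧ colourMult G S x y < θ).card : ℝ) := by exact_mod_cast h3
    linarith
  have hWcore : W ⊆ richCore G θ (D / 2) S U :=
    IsRichSet.subset_richCore (fun x hx => ⟨c, hc, hrich x hx⟩) (Finset.filter_subset _ _)
  refine ⟨c, hc, W, hWcore, ?_, fun x hx => (hrich x hx).trans ?_⟩
  · have h1 := hnbr _ (hG c).1.choose_spec
    have h2 : (((Finset.univ.filter fun z => (G c).Adj (hG c).1.choose z) ∩ W).card : ℝ) ≤
        W.card := by exact_mod_cast Finset.card_le_card Finset.inter_subset_right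
    linarith
  · exact_mod_cast Finset.card_le_card (richNbhd_mono subset_rfl hWcore c x)

variable [DecidableEq γ]

theorem IsRainbowWalkIn.cons {L : ℕ} {f : ℕ → Fin n} {col : ℕ → γ} {x : Fin n} {c : γ}
    (h : IsRainbowWalkIn G (U.erase x) (S.erase c) L f col) (hx : x ∈ U) (hc : c ∈ S)
    (hadj : (G c).Adj x (f 0)) :
    IsRainbowWalkIn G U S (L + 1) (fun i => Nat.casesOn i x f) (fun i => Nat.casesOn i c col) := by
  refine ⟨?_, ?_, ?_, ?_, ?_⟩
  · rintro (_ | i) hi (_ | j) hj hij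
    · rfl
    · exact absurd hij.symm (Finset.ne_of_mem_erase (h.vertex_mem j (by simpa using hj)))
    · exact absurd hij (Finset.ne_of_mem_erase (h.vertex_mem i (by simpa using hi)))
    · simpa using h.injOn_vertex (by simpa using hi) (by simpa using hj) hij
  · rintro (_ | i) hi (_ | j) hj hij
    · rfl
    · exact absurd hij.symm (Finset.ne_of_mem_erase (h.colour_mem j (by simpa using hj)))
    · exact absurd hij (Finset.ne_of_mem_erase (h.colour_mem i (by simpa using hi)))
    · simpa using h.injOn_colour (by simpa using hi) (by simpa using hj) hij
  · rintro (_ | i) hi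
    · exact hx
    · exact Finset.mem_of_mem_erase (h.vertex_mem i (by simpa using hi))
  · rintro (_ | i) hi
    · exact hc
    · exact Finset.mem_of_mem_erase (h.colour_mem i (by simpa using hi))
  · rintro (_ | i) hi
    · exact hadj
    · exact h.adj i (by simpa using hi)

theorem image_casesOn_range_succ {β : Type*} [DecidableEq β] (a : β) (f : ℕ → β) (m : ℕ) :
    (Finset.range (m + 1)).image (fun i => (Nat.casesOn i a f : β)) =
      insert a ((Finset.range m).image f) := by
  rw [Finset.range_add_one', Finset.image_insert, Finset.map_eq_image, Finset.image_image]
  rfl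

/-- A path that is extended for as long as its end stays linked to half of `X` closes up into `X`
with a loss of many linked pairs. -/
theorem exists_rainbow_walk_losing_links (hdiam : 3 * (n : ℝ) < (θ + 1) * d) (hd : 2 < d)
    (X : Finset (Fin n)) (S : Finset γ) : ∀ (U : Finset (Fin n)) (x : Fin n),
    d / 2 ≤ ((X.filter (Linked G θ d S U x)).card : ℝ) →
    ∃ L f col c Y, 0 < L ∧ IsRainbowWalkIn G U S L f col ∧ f 0 = x ∧ f L ∈ X ∧ c ∈ S ∧
      d ≤ (Finset.card Y : ℝ) ∧ (∀ y ∈ Y, Linked G θ d S U x y) ∧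
      ∀ y ∈ Y, ((X.filter (Linked G θ d ((S \ (Finset.range L).image col).erase c)
        (U \ (Finset.range (L + 1)).image f) y)).card : ℝ) < d / 2 := by
  induction S using Finset.strongInduction with
  | H S ih =>
  intro U x hx
  have h1 : 1 < (X.filter (Linked G θ d S U x)).card := by
    have : (1 : ℝ) < (X.filter (Linked G θ d S U x)).card := by linarith
    exact_mod_cast this
  obtain ⟨z, hz, hzx⟩ := Finset.exists_mem_ne h1 x
  obtain ⟨hzX, hlink⟩ := Finset.mem_filter.1 hz
  have hxcore := hlink.1
  obtain ⟨c, hc, hdc⟩ := isRichSet_richCore x hxcore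
  by_cases hcont : ∃ y ∈ richNbhd G θ S (richCore G θ d S U) c x,
      d / 2 ≤ ((X.filter (Linked G θ d (S.erase c) (U.erase x) y)).card : ℝ)
  · obtain ⟨y, hy, hyX⟩ := hcont
    obtain ⟨L, f, col, c', Y, hL, hwalk, hf0, hfL, hc', hYd, hYlink, hYlost⟩ :=
      ih (S.erase c) (Finset.erase_ssubset hc) (U.erase x) y hyX
    have hxy := linked_of_mem_richNbhd hxcore hy
    refine ⟨L + 1, _, _, c', Y, by omega, hwalk.cons (richCore_subset hxcore) hc ?_, rfl, hfL,
      Finset.mem_of_mem_erase hc', hYd, ?_, ?_⟩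
    · rw [hf0]
      exact (Finset.mem_filter.1 hy).2.1
    · exact fun y' hy' => hxy.trans
        ((hYlink y' hy').mono (Finset.erase_subset _ _) (Finset.erase_subset _ _))
    · intro y' hy'
      have := hYlost y' hy'
      rw [image_casesOn_range_succ, image_casesOn_range_succ, Finset.sdiff_insert,
        Finset.sdiff_insert, ← Finset.erase_sdiff_comm S, ← Finset.erase_sdiff_comm U]
      exact this
  · push Not at hcont
    obtain ⟨L, f, col, hL, hwalk, hf0, hfL⟩ :=
      hlink.exists_rainbow_walk hdiam hzx.symm ⟨c, hc⟩
    refine ⟨L, f, col, c, _, hL, hwalk, hf0, hfL ▸ hzX, hc, hdc,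
      fun y hy => linked_of_mem_richNbhd hxcore hy, fun y hy => ?_⟩
    refine lt_of_le_of_lt ?_ (hcont y hy)
    norm_cast
    refine Finset.card_le_card fun w hw => ?_
    obtain ⟨hwX, hw⟩ := Finset.mem_filter.1 hw
    refine Finset.mem_filter.2 ⟨hwX, hw.mono ?_ ?_⟩
    · exact Finset.erase_subset_erase _ Finset.sdiff_subset
    · intro v hv
      obtain ⟨hvU, hv⟩ := Finset.mem_sdiff.1 hv
      refine Finset.mem_erase.2 ⟨?_, hvU⟩
      rintro rfl
      exact hv (Finset.mem_image.2 ⟨0, by simp, hf0⟩)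

theorem IsRainbowWalkIn.isRainbowCycle {L : ℕ} {f : ℕ → Fin n} {col : ℕ → γ} {c : γ}
    (h : IsRainbowWalkIn G U (S.erase c) L f col) (hL : 0 < L) (hadj : (G c).Adj (f L) (f 0)) :
    IsRainbowCycle G ((Finset.range (L + 1)).image f)
      (insert c ((Finset.range L).image col)) := by
  refine Or.inr ⟨L + 1, fun i => f (i % (L + 1)),
    fun i => if i % (L + 1) = L then c else col (i % (L + 1)), by omega, ?_, ?_, ?_, ?_, ?_, ?_,
    ?_, ?_⟩
  · rw [Finset.card_image_of_injOn, Finset.card_range]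
    exact h.injOn_vertex.mono fun i hi => by simpa [Nat.lt_succ_iff] using hi
  · simp
  · intro i hi j hj hij
    simp only [Set.mem_Iio] at hi hj
    simp only [Nat.mod_eq_of_lt hi, Nat.mod_eq_of_lt hj] at hij
    exact h.injOn_vertex (Nat.lt_succ_iff.1 hi) (Nat.lt_succ_iff.1 hj) hij
  · refine Finset.image_congr fun i hi => ?_
    rw [Nat.mod_eq_of_lt (by simpa using hi)]
  · simp
  · intro i hi j hj hij
    simp only [Set.mem_Iio] at hi hj
    simp only [Nat.mod_eq_of_lt hi, Nat.mod_eq_of_lt hj] at hij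
    split_ifs at hij with h1 h2 h2
    · omega
    · exact absurd hij.symm (Finset.ne_of_mem_erase (h.colour_mem j (by omega)))
    · exact absurd hij (Finset.ne_of_mem_erase (h.colour_mem i (by omega)))
    · exact h.injOn_colour (Set.mem_Iio.2 (by omega)) (Set.mem_Iio.2 (by omega)) hij
  · rw [Finset.range_add_one, Finset.image_insert]
    congr 1
    · simp
    · refine Finset.image_congr fun i hi => ?_
      have hi : i < L := by simpa using hi
      simp only [Nat.mod_eq_of_lt (by omega : i < L + 1), hi.ne, if_false]
  · intro i
    have hlt : i % (L + 1) < L + 1 := Nat.mod_lt _ (by omega)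
    rcases Nat.lt_succ_iff_lt_or_eq.1 hlt with h1 | h1
    · have h2 : (i + 1) % (L + 1) = i % (L + 1) + 1 := by
        rw [Nat.add_mod, Nat.mod_eq_of_lt (by omega : 1 < L + 1), Nat.mod_eq_of_lt (by omega)]
      simp only [h1.ne, if_false, h2]
      exact h.adj _ h1
    · have h2 : (i + 1) % (L + 1) = 0 := by
        rw [Nat.add_mod, Nat.mod_eq_of_lt (by omega : 1 < L + 1), h1, Nat.mod_self]
      simp only [h1, if_true, h2]
      exact hadj

theorem IsRainbowWalkIn.card_colours {L : ℕ} {f : ℕ → Fin n} {col : ℕ → γ}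
    (h : IsRainbowWalkIn G U S L f col) : ((Finset.range L).image col).card = L := by
  rw [Finset.card_image_of_injOn, Finset.card_range]
  exact h.injOn_colour.mono fun i hi => by simpa using hi

theorem exists_cycle_losing_links (hdiam : 3 * (n : ℝ) < (θ + 1) * d) (hd : 2 < d)
    {c : γ} (hc : c ∈ S) {W : Finset (Fin n)} (hWU : W ⊆ richCore G θ d S U)
    (hW : d ≤ (W.card : ℝ))
    (hrich : ∀ x ∈ W, d ≤ ((richNbhd G θ S (richCore G θ d S U) c x).card : ℝ)) :
    ∃ s k c', IsRainbowCycle G s k ∧ s ⊆ U ∧ k ⊆ S ∧ k.Nonempty ∧ s.card ≤ 2 * k.card ∧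
      c' ∈ S ∧ ((linkedPairs G θ d ((S \ k).erase c') (U \ s)).card : ℝ) + d ^ 2 / 2 ≤
        (linkedPairs G θ d S U).card := by
  by_cases hgo : ∃ x ∈ W, d / 2 ≤ (((richNbhd G θ S (richCore G θ d S U) c x).filter
      (Linked G θ d (S.erase c) U x)).card : ℝ)
  · obtain ⟨x, hxW, hx⟩ := hgo
    obtain ⟨L, f, col, c', Y, hL, hwalk, hf0, hfL, hc', hYd, hYlink, hYlost⟩ :=
      exists_rainbow_walk_losing_links hdiam hd _ _ _ _ hx
    have hck : c ∉ (Finset.range L).image col := by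
      simp only [Finset.mem_image, Finset.mem_range, not_exists, not_and]
      exact fun i hi => Finset.ne_of_mem_erase (hwalk.colour_mem i hi)
    refine ⟨_, _, c', hwalk.isRainbowCycle hL ?_, ?_, ?_, by simp, ?_,
      Finset.mem_of_mem_erase hc', ?_⟩
    · rw [hf0]
      exact (Finset.mem_filter.1 hfL).2.1.symm
    · intro v hv
      obtain ⟨i, hi, rfl⟩ := Finset.mem_image.1 hv
      exact hwalk.vertex_mem i (by simpa [Nat.lt_succ_iff] using hi)
    · refine Finset.insert_subset hc fun b hb => ?_
      obtain ⟨i, hi, rfl⟩ := Finset.mem_image.1 hb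
      exact Finset.mem_of_mem_erase (hwalk.colour_mem i (by simpa using hi))
    · rw [hwalk.card_vertices, Finset.card_insert_of_notMem hck, hwalk.card_colours]
      omega
    · refine card_linkedPairs_add_le ((Finset.erase_subset _ _).trans Finset.sdiff_subset)
        Finset.sdiff_subset (by linarith) hYd
        (fun _ => richNbhd G θ S (richCore G θ d S U) c x) (fun _ _ => hrich x hxW) ?_ ?_
      · intro y hy z hz
        exact ((hYlink y hy).mono (Finset.erase_subset _ _) subset_rfl).symm.trans
          (linked_of_mem_richNbhd (hWU hxW) hz)
      · intro y hy
        have := hYlost y hy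
        rwa [Finset.erase_sdiff_comm, ← Finset.sdiff_insert] at this
  · push Not at hgo
    have hWne : W.Nonempty := by
      rw [← Finset.card_pos]
      have : (0 : ℝ) < W.card := by linarith
      exact_mod_cast this
    obtain ⟨x, hxW⟩ := hWne
    have hne : (richNbhd G θ S (richCore G θ d S U) c x).Nonempty := by
      rw [← Finset.card_pos]
      have := hrich x hxW
      have : (0 : ℝ) < (richNbhd G θ S (richCore G θ d S U) c x).card := by linarith
      exact_mod_cast this
    obtain ⟨y, hy⟩ := hne
    refine ⟨{x, y}, {c}, c, Or.inl ⟨x, y, c, (Finset.mem_filter.1 hy).2.1, rfl, rfl⟩, ?_,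
      by simpa using hc, by simp, by simpa using Finset.card_le_two, hc, ?_⟩
    · intro v hv
      rcases Finset.mem_insert.1 hv with rfl | hv
      · exact richCore_subset (hWU hxW)
      · rw [Finset.mem_singleton.1 hv]
        exact richCore_subset (Finset.mem_filter.1 hy).1
    · refine card_linkedPairs_add_le ((Finset.erase_subset _ _).trans Finset.sdiff_subset)
        Finset.sdiff_subset (by linarith) hW
        (fun x => richNbhd G θ S (richCore G θ d S U) c x) hrich
        (fun x hx z hz => linked_of_mem_richNbhd (hWU hx) hz) fun x hx => ?_
      refine lt_of_le_of_lt ?_ (hgo x hx)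
      norm_cast
      refine Finset.card_le_card fun w hw => ?_
      obtain ⟨hwX, hw⟩ := Finset.mem_filter.1 hw
      refine Finset.mem_filter.2 ⟨hwX, hw.mono ?_ Finset.sdiff_subset⟩
      rw [Finset.sdiff_singleton_eq_erase, Finset.erase_idem]

/-- The colours of `S` are split among `t` vertex-disjoint rainbow cycles inside `U`. -/
def HasCycleSystem (G : γ → SimpleGraph (Fin n)) (U : Finset (Fin n)) (S : Finset γ) (t : ℕ) :
    Prop :=
  ∃ (s : Fin t → Finset (Fin n)) (k : Fin t → Finset γ),
    (∀ a, IsRainbowCycle G (s a) (k a)) ∧ (∀ a, s a ⊆ U) ∧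
    (∀ a b, a ≠ b → Disjoint (s a) (s b)) ∧ (∀ a b, a ≠ b → Disjoint (k a) (k b)) ∧
    Finset.univ.biUnion k = S

theorem hasCycleSystem_empty : HasCycleSystem G U ∅ 0 :=
  ⟨fun _ => ∅, fun _ => ∅, fun a => a.elim0, fun a => a.elim0, fun a => a.elim0,
    fun a => a.elim0, rfl⟩

theorem HasCycleSystem.cons {s : Finset (Fin n)} {k : Finset γ} {t : ℕ}
    (h : HasCycleSystem G (U \ s) (S \ k) t) (hcyc : IsRainbowCycle G s k) (hs : s ⊆ U)
    (hk : k ⊆ S) : HasCycleSystem G U S (t + 1) := by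
  obtain ⟨s', k', h1, h2, h3, h4, h5⟩ := h
  have hs' : ∀ a, Disjoint s (s' a) := fun a =>
    Finset.disjoint_sdiff.mono_right (h2 a)
  have hk' : ∀ a, Disjoint k (k' a) := fun a =>
    Finset.disjoint_sdiff.mono_right (h5 ▸ Finset.subset_biUnion_of_mem k' (Finset.mem_univ a))
  refine ⟨Fin.cons s s', Fin.cons k k', ?_, ?_, ?_, ?_, ?_⟩
  · exact fun a => Fin.cases hcyc h1 a
  · exact fun a => Fin.cases hs (fun a => (h2 a).trans Finset.sdiff_subset) a
  · intro a b
    refine Fin.cases (Fin.cases (by simp) (fun b _ => by simpa using hs' b) b) (fun a => ?_) a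
    refine Fin.cases (fun _ => by simpa using (hs' a).symm) (fun b hab => ?_) b
    simpa using h3 a b fun h => hab (h ▸ rfl)
  · intro a b
    refine Fin.cases (Fin.cases (by simp) (fun b _ => by simpa using hk' b) b) (fun a => ?_) a
    refine Fin.cases (fun _ => by simpa using (hk' a).symm) (fun b hab => ?_) b
    simpa using h4 a b fun h => hab (h ▸ rfl)
  · ext c
    simp only [Finset.mem_biUnion, Finset.mem_univ, true_and, Fin.exists_fin_succ, Fin.cons_zero,
      Fin.cons_succ]
    have := Finset.ext_iff.1 h5 c
    simp only [Finset.mem_biUnion, Finset.mem_univ, true_and, Finset.mem_sdiff] at this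
    rw [this]
    have := @hk c
    tauto

theorem cast_card_compl_sdiff {s : Finset (Fin n)} (hs : s ⊆ U) :
    (((U \ s)ᶜ).card : ℝ) = (Uᶜ.card : ℝ) + s.card := by
  have h1 := Finset.card_compl (U \ s)
  have h2 := Finset.card_compl U
  have h3 := Finset.card_sdiff_of_subset hs
  have h4 := Finset.card_le_card hs
  have h5 := Finset.card_le_univ U
  exact_mod_cast (by omega : ((U \ s)ᶜ).card = Uᶜ.card + s.card)

theorem MinMonDegree.hasCycleSystem_card {D : ℝ} (hG : MinMonDegree G D) (S : Finset γ) :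
    ∀ U : Finset (Fin n), (Uᶜ.card : ℝ) + 2 * S.card < D → HasCycleSystem G U S S.card := by
  induction S using Finset.induction_on with
  | empty => exact fun U _ => hasCycleSystem_empty
  | insert c S hc ih =>
    intro U hU
    rw [Finset.card_insert_of_notMem hc] at hU ⊢
    push_cast at hU
    have hpos : (0 : ℝ) ≤ S.card := by positivity
    obtain ⟨x, hx, y, hy, hxy⟩ := hG.exists_adj_mem (U := U) (by linarith) c
    have hsub : ({x, y} : Finset (Fin n)) ⊆ U := by
      simp [Finset.insert_subset_iff, hx, hy]
    refine HasCycleSystem.cons (s := {x, y}) (k := {c}) ?_ (Or.inl ⟨x, y, c, hxy, rfl, rfl⟩)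
      hsub (by simp)
    rw [Finset.sdiff_singleton_eq_erase, Finset.erase_insert hc]
    refine ih _ ?_
    rw [cast_card_compl_sdiff hsub]
    have : ((({x, y} : Finset (Fin n)).card : ℕ) : ℝ) ≤ 2 := by exact_mod_cast Finset.card_le_two
    linarith

theorem MinMonDegree.exists_hasCycleSystem {D K : ℝ} (hG : MinMonDegree G D)
    (hdiam : 3 * (n : ℝ) < (θ + 1) * (D / 2)) (hD : 4 < D)
    (hK : ∀ m : ℕ, K < m → 32 * θ * (n : ℝ) ^ 2 < m * D ^ 2) (hK0 : 0 ≤ K) (S : Finset γ) :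
    ∀ U : Finset (Fin n), (Uᶜ.card : ℝ) + 2 * S.card ≤ D / 8 → ∃ t, HasCycleSystem G U S t ∧
      (t : ℝ) * (D ^ 2 / 16) ≤ (linkedPairs G θ (D / 2) S U).card + K * (D ^ 2 / 16) := by
  induction S using Finset.strongInduction with
  | H S ih =>
  intro U hU
  rcases le_or_gt (S.card : ℝ) K with hSK | hSK
  · refine ⟨S.card, hG.hasCycleSystem_card S U (by linarith), ?_⟩
    have : (S.card : ℝ) * (D ^ 2 / 16) ≤ K * (D ^ 2 / 16) := by gcongr
    have : (0 : ℝ) ≤ (linkedPairs G θ (D / 2) S U).card := by positivity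
    linarith
  have hSpos : (0 : ℝ) ≤ S.card := by positivity
  obtain ⟨c₀, hc₀, W, hWcore, hWcard, hrich⟩ :=
    hG.exists_rich_colour (by linarith) (by linarith : (Uᶜ.card : ℝ) ≤ D / 8) (hK _ hSK)
  obtain ⟨s, k, c, hcyc, hs, hk, hkne, hsk, hc, hloss⟩ :=
    exists_cycle_losing_links hdiam (by linarith) hc₀ hWcore hWcard hrich
  have hk_pos := Finset.card_pos.2 hkne
  have hSk : ((S \ k).card : ℝ) + k.card = S.card := by
    exact_mod_cast Finset.card_sdiff_add_card_eq_card hk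
  have hsk' : (s.card : ℝ) ≤ 2 * k.card := by exact_mod_cast hsk
  have hbound : (((U \ s)ᶜ).card : ℝ) + 2 * (S \ k).card ≤ D / 8 := by
    rw [cast_card_compl_sdiff hs]
    linarith
  have hssub : S \ k ⊂ S := by
    refine Finset.ssubset_iff_subset_ne.2 ⟨Finset.sdiff_subset, fun h => ?_⟩
    rw [h] at hSk
    have : (0 : ℝ) < k.card := by exact_mod_cast hk_pos
    linarith
  by_cases hck : c ∈ S \ k
  · have hSk_pos : (((S \ k).erase c).card : ℝ) + 1 = (S \ k).card := by
      exact_mod_cast Finset.card_erase_add_one hck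
    have hnn : (0 : ℝ) ≤ ((S \ k).erase c).card := by positivity
    obtain ⟨x, hx, y, hy, hxy⟩ := hG.exists_adj_mem (U := U \ s)
      (by linarith only [hbound, hSk_pos, hnn, hD]) c
    have hsub : ({x, y} : Finset (Fin n)) ⊆ U \ s :=
      Finset.insert_subset hx (Finset.singleton_subset_iff.2 hy)
    have hcard : ((({x, y} : Finset (Fin n)).card : ℕ) : ℝ) ≤ 2 := by
      exact_mod_cast Finset.card_le_two
    obtain ⟨t, ht, htle⟩ := ih ((S \ k).erase c)
      ((Finset.erase_subset _ _).trans_ssubset hssub) ((U \ s) \ {x, y}) (by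
        rw [cast_card_compl_sdiff hsub]
        linarith only [hbound, hcard, hSk_pos])
    rw [← Finset.sdiff_singleton_eq_erase] at ht
    refine ⟨t + 1 + 1, (ht.cons (Or.inl ⟨x, y, c, hxy, rfl, rfl⟩) hsub
      (by simpa using hck)).cons hcyc hs hk, ?_⟩
    have hmono : ((linkedPairs G θ (D / 2) ((S \ k).erase c) ((U \ s) \ {x, y})).card : ℝ) ≤
        (linkedPairs G θ (D / 2) ((S \ k).erase c) (U \ s)).card :=
      Nat.cast_le.2 (Finset.card_le_card (linkedPairs_mono subset_rfl Finset.sdiff_subset))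
    push_cast
    linarith only [htle, hloss, hmono]
  · obtain ⟨t, ht, htle⟩ := ih (S \ k) hssub (U \ s) hbound
    rw [Finset.erase_eq_of_notMem hck] at hloss
    refine ⟨t + 1, ht.cons hcyc hs hk, ?_⟩
    push_cast
    linarith only [htle, hloss, sq_nonneg D]

end RainbowCycleSystem

theorem rainbow_cycle_system (δ₀ : ℝ) (hδ0 : 0 < δ₀) (hδ1 : δ₀ ≤ 1 / 8) :
    ∃ n₀ : ℕ, ∀ n : ℕ, n₀ ≤ n →
      ∀ (γ : Type) [Fintype γ] [DecidableEq γ] (G : γ → SimpleGraph (Fin n)),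
        (∀ c : γ, (G c).edgeSet.Nonempty) →
        (∀ (c : γ) (v : Fin n), ((G c).neighborSet v).Nonempty →
          δ₀ * n ≤ (((G c).neighborSet v).ncard : ℝ)) →
        (Fintype.card γ : ℝ) ≤ δ₀ * n / 16 →
        ∃ (t : ℕ) (S : Fin t → Finset (Fin n)) (K : Fin t → Finset γ),
          (∀ a, IsRainbowCycle G (S a) (K a)) ∧
          (∀ a b, a ≠ b → Disjoint (S a) (S b)) ∧
          (∀ a b, a ≠ b → Disjoint (K a) (K b)) ∧
          Finset.univ.biUnion K = Finset.univ ∧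
          (t : ℝ) ≤ 2 ^ 18 / δ₀ ^ 5 := by
  classical
  refine ⟨⌈5 / δ₀⌉₊, fun n hn γ _ _ G hne hdeg hcard => ?_⟩
  have hnδ : 5 ≤ δ₀ * n := by
    have := (div_le_iff₀ hδ0).1 (Nat.ceil_le.1 hn)
    linarith
  have hn0 : (0 : ℝ) < n := by
    by_contra! h
    nlinarith
  have hG : MinMonDegree G (δ₀ * n) := by
    refine fun c => ⟨?_, fun x y hxy => ?_⟩
    · obtain ⟨e, he⟩ := hne c
      induction e with
      | h x y => exact ⟨x, y, he⟩
    · refine (hdeg c x ⟨y, hxy⟩).trans_eq ?_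
      rw [← Set.ncard_coe_finset]
      congr 2
      ext z
      simp
  set θ := ⌈6 / δ₀⌉₊ with hθ
  have hθ1 : 6 / δ₀ ≤ θ := Nat.le_ceil _
  have hθ2 : (θ : ℝ) ≤ 7 / δ₀ := by
    have h1 := Nat.ceil_lt_add_one (a := 6 / δ₀) (by positivity)
    have h2 : 1 ≤ 1 / δ₀ := by rw [le_div_iff₀ hδ0]; linarith
    have h3 : 7 / δ₀ = 6 / δ₀ + 1 / δ₀ := by ring
    linarith
  have hθδ : 6 ≤ θ * δ₀ := (div_le_iff₀ hδ0).1 hθ1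
  obtain ⟨t, ⟨S, K, h1, -, h3, h4, h5⟩, ht⟩ := hG.exists_hasCycleSystem (θ := θ)
    (K := 32 * θ / δ₀ ^ 2) (by nlinarith) (by linarith) (fun m hm => by
      rw [div_lt_iff₀ (by positivity)] at hm
      calc _ < m * δ₀ ^ 2 * (n : ℝ) ^ 2 := by gcongr
        _ = _ := by ring) (by positivity) Finset.univ Finset.univ (by
      simp only [Finset.compl_univ, Finset.card_empty, Finset.card_univ]
      push_cast
      linarith)
  refine ⟨t, S, K, h1, h3, h4, h5, ?_⟩
  have hpairs : ((linkedPairs G θ (δ₀ * n / 2) Finset.univ Finset.univ).card : ℝ) ≤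
      (n : ℝ) ^ 2 := by
    have := Finset.card_le_univ (linkedPairs G θ (δ₀ * n / 2) Finset.univ Finset.univ)
    rw [Fintype.card_prod, Fintype.card_fin, ← sq] at this
    exact_mod_cast this
  have ht2 : (t : ℝ) ≤ 16 / δ₀ ^ 2 + 32 * θ / δ₀ ^ 2 := by
    have hpos : 0 < (δ₀ * n) ^ 2 / 16 := by positivity
    refine le_of_mul_le_mul_right (ht.trans ?_) hpos
    have : 16 / δ₀ ^ 2 * ((δ₀ * n) ^ 2 / 16) = (n : ℝ) ^ 2 := by field_simp
    rw [add_mul, this]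
    linarith
  refine ht2.trans ?_
  rw [← add_div, div_le_div_iff₀ (by positivity) (by positivity)]
  have h6 : (θ : ℝ) * δ₀ ≤ 7 := (le_div_iff₀ hδ0).1 hθ2
  calc (16 + 32 * (θ : ℝ)) * δ₀ ^ 5 = (16 * δ₀ + 32 * (θ * δ₀)) * δ₀ ^ 2 * δ₀ ^ 2 := by ring
    _ ≤ (16 * 1 + 32 * 7) * 1 ^ 2 * δ₀ ^ 2 := by gcongr <;> linarith
    _ ≤ 2 ^ 18 * δ₀ ^ 2 := by gcongr; norm_num
end
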